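/- Let (p_{k,ℓ}) be symmetric weights with bounded jumps as in the context, and let t₀ = min_{a∈ℝ²} φ(a) (by symmetry t₀ = φ(0,0) = 1). Then the t₀-harmonic function is unique up to a multiplicative constant: if f and g are both t₀-harmonic functions, then there exists c > 0 with g(i,j) = c·f(i,j) for all (i,j) ∈ ℤ². -/

import Mathlib

/-- The Laplace transform `φ(a₁,a₂) = Σ p_{k,ℓ} e^{k a₁ + ℓ a₂}`. -/
noncomputable def phiT (p : ℤ × ℤ → ℝ) (a : ℝ × ℝ) : ℝ :=
  ∑' kl : ℤ × ℤ, p kl * Real.exp (kl.1 * a.1 + kl.2 * a.2)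

/-- `f` is `t`-harmonic for the walk with weights `p` (finitely supported) killed at the
boundary of the quadrant. -/
def THarmonicF (p : ℤ × ℤ → ℝ) (t : ℝ) (f : ℤ → ℤ → ℝ) : Prop :=
  (∀ i j : ℤ, 1 ≤ i → 1 ≤ j →
    ∑' kl : ℤ × ℤ, p kl * f (i + kl.1) (j + kl.2) = t * f i j) ∧
  (∀ i j : ℤ, 1 ≤ i → 1 ≤ j → 0 < f i j) ∧
  (∀ i j : ℤ, i ≤ 0 ∨ j ≤ 0 → f i j = 0)

structure QWalk (S : Finset (ℤ × ℤ)) (p : ℤ × ℤ → ℝ) : Prop where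
  pos : ∀ s ∈ S, 0 < p s
  sum : ∑ s ∈ S, p s = 1
  neg_mem : ∀ s ∈ S, -s ∈ S
  symm : ∀ s, p (-s) = p s
  gen : AddSubgroup.closure (S : Set (ℤ × ℤ)) = ⊤

/-- the open quadrant -/
def InQ (x : ℤ × ℤ) : Prop := 1 ≤ x.1 ∧ 1 ≤ x.2

/-- averaging operator -/
noncomputable def avg (S : Finset (ℤ × ℤ)) (p : ℤ × ℤ → ℝ) (h : ℤ × ℤ → ℝ) (x : ℤ × ℤ) : ℝ :=
  ∑ s ∈ S, p s * h (x + s)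

/-- nonnegative harmonic functions killed outside the quadrant -/
structure NHarm (S : Finset (ℤ × ℤ)) (p : ℤ × ℤ → ℝ) (h : ℤ × ℤ → ℝ) : Prop where
  eq : ∀ x, InQ x → avg S p h x = h x
  nonneg : ∀ x, 0 ≤ h x
  zero : ∀ x, ¬ InQ x → h x = 0

/-- uniform Harnack comparability of two points -/
def Comp (S : Finset (ℤ × ℤ)) (p : ℤ × ℤ → ℝ) (x y : ℤ × ℤ) : Prop :=
  InQ x ∧ InQ y ∧ ∃ c : ℝ, 0 < c ∧ ∀ h, NHarm S p h → ∀ w : ℤ × ℤ, 0 ≤ w.1 → 0 ≤ w.2 →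
    c * h (y + w) ≤ h (x + w)

section Irred

variable {S : Finset (ℤ × ℤ)} {p : ℤ × ℤ → ℝ}

theorem InQ.add {x w : ℤ × ℤ} (hx : InQ x) (h1 : 0 ≤ w.1) (h2 : 0 ≤ w.2) : InQ (x + w) := by
  obtain ⟨a, b⟩ := hx
  constructor
  · simp only [Prod.fst_add]; omega
  · simp only [Prod.snd_add]; omega

theorem Comp.refl {x : ℤ × ℤ} (hx : InQ x) : Comp S p x x :=
  ⟨hx, hx, 1, one_pos, fun h _ w _ _ => by simp⟩

theorem Comp.trans {x y z : ℤ × ℤ} (h1 : Comp S p x y) (h2 : Comp S p y z) : Comp S p x z := by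
  obtain ⟨hx, hy, c, hc, H⟩ := h1
  obtain ⟨_, hz, d, hd, H'⟩ := h2
  refine ⟨hx, hz, c * d, mul_pos hc hd, fun h hh w w1 w2 => ?_⟩
  have a := H h hh w w1 w2
  have b := H' h hh w w1 w2
  calc c * d * h (z + w) = c * (d * h (z + w)) := by ring
    _ ≤ c * h (y + w) := by gcongr
    _ ≤ _ := a

theorem Comp.shift {x y u : ℤ × ℤ} (h1 : Comp S p x y) (u1 : 0 ≤ u.1) (u2 : 0 ≤ u.2) :
    Comp S p (x + u) (y + u) := by
  obtain ⟨hx, hy, c, hc, H⟩ := h1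
  refine ⟨hx.add u1 u2, hy.add u1 u2, c, hc, fun h hh w w1 w2 => ?_⟩
  have := H h hh (u + w) (by simp only [Prod.fst_add]; omega) (by simp only [Prod.snd_add]; omega)
  simpa [add_assoc] using this

theorem NHarm.step_le (hw : QWalk S p) {h : ℤ × ℤ → ℝ} (hh : NHarm S p h) {x s : ℤ × ℤ}
    (hx : InQ x) (hs : s ∈ S) : p s * h (x + s) ≤ h x := by
  rw [← hh.eq x hx]
  exact Finset.single_le_sum (f := fun s => p s * h (x + s))
    (fun i hi => mul_nonneg (hw.pos i hi).le (hh.nonneg _)) hs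

theorem Comp.step (hw : QWalk S p) {x s : ℤ × ℤ} (hx : InQ x) (hxs : InQ (x + s)) (hs : s ∈ S) :
    Comp S p x (x + s) := by
  refine ⟨hx, hxs, p s, hw.pos s hs, fun h hh w w1 w2 => ?_⟩
  have := hh.step_le hw (hx.add w1 w2) hs
  rwa [add_right_comm] at this

/-- any lattice displacement is possible deep inside the quadrant -/
theorem Comp.deep (hw : QWalk S p) (z : ℤ × ℤ) :
    ∃ N : ℤ, 1 ≤ N ∧ ∀ x : ℤ × ℤ, N ≤ x.1 → N ≤ x.2 → Comp S p x (x + z) ∧ Comp S p (x + z) x := by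
  have hz : z ∈ AddSubgroup.closure (S : Set (ℤ × ℤ)) := by rw [hw.gen]; trivial
  induction hz using AddSubgroup.closure_induction with
  | mem s hs =>
    have a1 := abs_nonneg s.1
    have a2 := abs_nonneg s.2
    have b1 := neg_abs_le s.1
    have b2 := neg_abs_le s.2
    refine ⟨1 + |s.1| + |s.2|, by omega, fun x h1 h2 => ?_⟩
    have hx : InQ x := ⟨by omega, by omega⟩
    have hxs : InQ (x + s) := ⟨by simp only [Prod.fst_add]; omega, by simp only [Prod.snd_add]; omega⟩
    refine ⟨Comp.step hw hx hxs hs, ?_⟩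
    have := Comp.step hw hxs (s := -s) (by simpa using hx) (hw.neg_mem s hs)
    simpa using this
  | zero =>
    refine ⟨1, le_rfl, fun x h1 h2 => ?_⟩
    simpa using Comp.refl (S := S) (p := p) (x := x) ⟨h1, h2⟩
  | add a b _ _ ha hb =>
    obtain ⟨N, hN, HN⟩ := ha
    obtain ⟨M, hM, HM⟩ := hb
    have a1 := abs_nonneg a.1
    have a2 := abs_nonneg a.2
    have b1 := neg_abs_le a.1
    have b2 := neg_abs_le a.2
    refine ⟨N + M + |a.1| + |a.2|, by omega, fun x h1 h2 => ?_⟩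
    obtain ⟨u1, u2⟩ := HN x (by omega) (by omega)
    obtain ⟨v1, v2⟩ := HM (x + a) (by simp only [Prod.fst_add]; omega)
      (by simp only [Prod.snd_add]; omega)
    rw [← add_assoc]
    exact ⟨u1.trans v1, v2.trans u2⟩
  | neg a _ ha =>
    obtain ⟨N, hN, HN⟩ := ha
    have a1 := abs_nonneg a.1
    have a2 := abs_nonneg a.2
    have b1 := le_abs_self a.1
    have b2 := le_abs_self a.2
    refine ⟨N + |a.1| + |a.2|, by omega, fun x h1 h2 => ?_⟩
    obtain ⟨u1, u2⟩ := HN (x + -a) (by simp only [Prod.fst_add, Prod.fst_neg]; omega)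
      (by simp only [Prod.snd_add, Prod.snd_neg]; omega)
    rw [neg_add_cancel_right] at u1 u2
    exact ⟨u2, u1⟩

/-- both comparisons -/
def Comp2 (S : Finset (ℤ × ℤ)) (p : ℤ × ℤ → ℝ) (x y : ℤ × ℤ) : Prop :=
  Comp S p x y ∧ Comp S p y x

theorem Comp2.refl {x : ℤ × ℤ} (hx : InQ x) : Comp2 S p x x := ⟨Comp.refl hx, Comp.refl hx⟩

theorem Comp2.symm {x y : ℤ × ℤ} (h : Comp2 S p x y) : Comp2 S p y x := ⟨h.2, h.1⟩

theorem Comp2.trans {x y z : ℤ × ℤ} (h1 : Comp2 S p x y) (h2 : Comp2 S p y z) : Comp2 S p x z :=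
  ⟨h1.1.trans h2.1, h2.2.trans h1.2⟩

theorem Comp2.shift {x y u : ℤ × ℤ} (h1 : Comp2 S p x y) (u1 : 0 ≤ u.1) (u2 : 0 ≤ u.2) :
    Comp2 S p (x + u) (y + u) := ⟨h1.1.shift u1 u2, h1.2.shift u1 u2⟩

theorem Comp2.step (hw : QWalk S p) {x s : ℤ × ℤ} (hx : InQ x) (hxs : InQ (x + s)) (hs : s ∈ S) :
    Comp2 S p x (x + s) := by
  refine ⟨Comp.step hw hx hxs hs, ?_⟩
  have := Comp.step hw hxs (s := -s) (by simpa using hx) (hw.neg_mem s hs)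
  simpa using this

theorem Comp2.iter {x v : ℤ × ℤ} (h : Comp2 S p x (x + v)) (v1 : 0 ≤ v.1) (v2 : 0 ≤ v.2) (n : ℕ) :
    Comp2 S p x (x + n • v) := by
  induction n with
  | zero => simpa using Comp2.refl (S := S) (p := p) h.1.1
  | succ n ih =>
    have := h.shift (u := n • v) (by simp only [Prod.smul_fst]; positivity)
      (by simp only [Prod.smul_snd]; positivity)
    have e : x + v + n • v = x + (n + 1) • v := by rw [add_smul, one_smul]; abel
    rw [e] at this
    exact ih.trans this

/-- there is a jump not along the first axis etc. -/
theorem exists_fst_pos (hw : QWalk S p) : ∃ s ∈ S, 0 < s.1 := by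
  by_contra! H
  have H0 : ∀ s ∈ S, s.1 = 0 := by
    intro s hs
    have h1 := H s hs
    have h2 := H (-s) (hw.neg_mem s hs)
    simp only [Prod.fst_neg] at h2
    omega
  have : AddSubgroup.closure (S : Set (ℤ × ℤ)) ≤ (AddMonoidHom.fst ℤ ℤ).ker := by
    rw [AddSubgroup.closure_le]
    intro s hs
    exact (AddMonoidHom.mem_ker).2 (H0 s hs)
  rw [hw.gen] at this
  have h1 := (AddMonoidHom.mem_ker).1 (this (AddSubgroup.mem_top ((1, 0) : ℤ × ℤ)))
  exact one_ne_zero h1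

theorem exists_snd_pos (hw : QWalk S p) : ∃ s ∈ S, 0 < s.2 := by
  by_contra! H
  have H0 : ∀ s ∈ S, s.2 = 0 := by
    intro s hs
    have h1 := H s hs
    have h2 := H (-s) (hw.neg_mem s hs)
    simp only [Prod.snd_neg] at h2
    omega
  have : AddSubgroup.closure (S : Set (ℤ × ℤ)) ≤ (AddMonoidHom.snd ℤ ℤ).ker := by
    rw [AddSubgroup.closure_le]
    intro s hs
    exact (AddMonoidHom.mem_ker).2 (H0 s hs)
  rw [hw.gen] at this
  have h1 := (AddMonoidHom.mem_ker).1 (this (AddSubgroup.mem_top ((0, 1) : ℤ × ℤ)))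
  exact one_ne_zero h1

/-- If a positive harmonic function exists there is a nonzero jump in the closed quadrant. -/
theorem exists_good_step (hw : QWalk S p) {f : ℤ × ℤ → ℝ} (hf : NHarm S p f) (h1 : 0 < f (1, 1)) :
    ∃ s ∈ S, 0 ≤ s.1 ∧ 0 ≤ s.2 ∧ s ≠ 0 := by
  by_contra! H
  have e := hf.eq (1, 1) ⟨le_rfl, le_rfl⟩
  obtain ⟨r, hr, hr1⟩ := exists_fst_pos hw
  have hle : avg S p f (1, 1) ≤ ∑ s ∈ S.erase r, p s * f (1, 1) := by
    unfold avg
    rw [← Finset.add_sum_erase _ _ hr]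
    have hr2 : f ((1, 1) + r) = 0 := by
      apply hf.zero
      rintro ⟨a, b⟩
      simp only [Prod.fst_add, Prod.snd_add] at a b
      have := H r hr (by omega) (by omega)
      simp [this] at hr1
    rw [hr2, mul_zero, zero_add]
    refine Finset.sum_le_sum fun s hs => ?_
    have hsS := Finset.mem_of_mem_erase hs
    refine mul_le_mul_of_nonneg_left ?_ (hw.pos s hsS).le
    by_cases hq : InQ ((1, 1) + s)
    · obtain ⟨a, b⟩ := hq
      simp only [Prod.fst_add, Prod.snd_add] at a b
      rw [H s hsS (by omega) (by omega)]
      simp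
    · rw [hf.zero _ hq]; exact h1.le
  rw [e, ← Finset.sum_mul] at hle
  have hs := hw.sum
  rw [← Finset.add_sum_erase _ _ hr] at hs
  have := hw.pos r hr
  nlinarith

theorem exists_deep_step (hw : QWalk S p) {f : ℤ × ℤ → ℝ} (hf : NHarm S p f) (h1 : 0 < f (1, 1)) :
    ∃ v : ℤ × ℤ, 1 ≤ v.1 ∧ 1 ≤ v.2 ∧ Comp2 S p (1, 1) ((1, 1) + v) := by
  obtain ⟨s, hs, s1, s2, s0⟩ := exists_good_step hw hf h1
  have hq : InQ (1, 1) := ⟨le_rfl, le_rfl⟩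
  have hstep := Comp2.step hw hq (hq.add s1 s2) hs
  have key : ∀ r ∈ S, ∀ n : ℕ, 1 ≤ n * s.1 + r.1 → 1 ≤ n * s.2 + r.2 →
      ∃ v : ℤ × ℤ, 1 ≤ v.1 ∧ 1 ≤ v.2 ∧ Comp2 S p (1, 1) ((1, 1) + v) := by
    intro r hr n a b
    refine ⟨n • s + r, by simpa using a, by simpa using b, ?_⟩
    rw [← add_assoc]
    refine (hstep.iter s1 s2 n).trans (Comp2.step hw (hstep.iter s1 s2 n).1.2.1 ?_ hr)
    constructor
    · simp; omega
    · simp; omega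
  rcases s1.lt_or_eq with a | a
  · obtain ⟨r, hr, hr2⟩ := exists_snd_pos hw
    refine key r hr (1 + r.1.natAbs) ?_ ?_
    · push_cast
      have := neg_abs_le r.1
      nlinarith [abs_nonneg r.1]
    · have : 0 ≤ ((1 + r.1.natAbs : ℕ) : ℤ) * s.2 := by positivity
      omega
  · have b : 0 < s.2 := by
      rcases s2.lt_or_eq with b | b
      · exact b
      · exact absurd (Prod.ext a.symm b.symm) s0
    obtain ⟨r, hr, hr2⟩ := exists_fst_pos hw
    refine key r hr (1 + r.2.natAbs) ?_ ?_
    · have : 0 ≤ ((1 + r.2.natAbs : ℕ) : ℤ) * s.1 := by positivity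
      omega
    · push_cast
      have := neg_abs_le r.2
      nlinarith [abs_nonneg r.2]

/-- irreducibility -/
theorem comp_all (hw : QWalk S p) {f : ℤ × ℤ → ℝ} (hf : NHarm S p f) (h1 : 0 < f (1, 1))
    {x y : ℤ × ℤ} (hx : InQ x) (hy : InQ y) : Comp2 S p x y := by
  have hq : InQ (1, 1) := ⟨le_rfl, le_rfl⟩
  obtain ⟨v, v1, v2, hv⟩ := exists_deep_step hw hf h1
  have main : ∀ u : ℤ × ℤ, 0 ≤ u.1 → 0 ≤ u.2 → Comp2 S p (1, 1) ((1, 1) + u) := by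
    intro u u1 u2
    obtain ⟨N, hN, H⟩ := Comp.deep hw u
    have a := hv.iter (by omega) (by omega) N.toNat
    have b := a.shift u1 u2
    have hmax : max N 0 = N := max_eq_left (by omega)
    have c := H ((1, 1) + N.toNat • v) (by simp [hmax]; nlinarith) (by simp [hmax]; nlinarith)
    exact (a.trans c).trans b.symm
  have m : ∀ x : ℤ × ℤ, InQ x → Comp2 S p (1, 1) x := by
    intro x hx
    have := main (x - (1, 1)) (by simpa using hx.1) (by simpa using hx.2)
    simpa using this
  exact (m x hx).symm.trans (m y hy)

/-- maximum principle -/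
theorem max_principle (hw : QWalk S p) (D : Finset (ℤ × ℤ)) (u : ℤ × ℤ → ℝ)
    (hsup : ∀ x ∈ D, avg S p u x ≤ u x)
    (hbd : ∀ x ∈ D, ∀ s ∈ S, x + s ∉ D → 0 ≤ u (x + s)) : ∀ x ∈ D, 0 ≤ u x := by
  by_contra! H
  obtain ⟨x0, hx0, hneg⟩ := H
  obtain ⟨m, hm, hmin⟩ := D.exists_min_image u ⟨x0, hx0⟩
  obtain ⟨r, hr, hr1⟩ := exists_fst_pos hw
  have hne : (D.filter (fun x => u x = u m)).Nonempty := ⟨m, by simp [hm]⟩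
  obtain ⟨z, hz, hzmax⟩ := Finset.exists_max_image _ (fun x : ℤ × ℤ => x.1) hne
  rw [Finset.mem_filter] at hz
  obtain ⟨hzD, hzu⟩ := hz
  have hum : u m < 0 := lt_of_le_of_lt (hmin x0 hx0) hneg
  have hge : ∀ s ∈ S, u m ≤ u (z + s) := by
    intro s hs
    by_cases hd : z + s ∈ D
    · exact hmin _ hd
    · exact hum.le.trans (hbd z hzD s hs hd)
  have hgt : u m < u (z + r) := by
    by_cases hd : z + r ∈ D
    · refine lt_of_le_of_ne (hmin _ hd) fun heq => ?_
      have := hzmax (z + r) (by simp [hd, heq])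
      simp only [Prod.fst_add] at this
      omega
    · exact hum.trans_le (hbd z hzD r hr hd)
  have h1 : ∑ s ∈ S, p s * u m < avg S p u z := by
    unfold avg
    refine Finset.sum_lt_sum (fun s hs => mul_le_mul_of_nonneg_left (hge s hs) (hw.pos s hs).le)
      ⟨r, hr, mul_lt_mul_of_pos_left hgt (hw.pos r hr)⟩
  rw [← Finset.sum_mul, hw.sum, one_mul] at h1
  have := hsup z hzD
  rw [hzu] at this
  linarith

end Irred
section Mono

open Filter Topology

variable {S : Finset (ℤ × ℤ)} {p : ℤ × ℤ → ℝ}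

instance : DecidablePred InQ := fun x => inferInstanceAs (Decidable (1 ≤ x.1 ∧ 1 ≤ x.2))

/-- killed transition operator -/
noncomputable def kill (S : Finset (ℤ × ℤ)) (p : ℤ × ℤ → ℝ) :
    Module.End ℝ (ℤ × ℤ → ℝ) where
  toFun h x := if InQ x then avg S p h x else 0
  map_add' h k := by
    ext x
    simp only [Pi.add_apply]
    split_ifs
    · simp [avg, mul_add, Finset.sum_add_distrib]
    · simp
  map_smul' c h := by
    ext x
    simp only [Pi.smul_apply, smul_eq_mul, RingHom.id_apply]
    split_ifs
    · simp only [avg, Pi.smul_apply, smul_eq_mul, Finset.mul_sum]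
      exact Finset.sum_congr rfl fun s _ => by ring
    · simp

theorem kill_apply (h : ℤ × ℤ → ℝ) (x : ℤ × ℤ) :
    kill S p h x = if InQ x then avg S p h x else 0 := rfl

theorem kill_mono (hw : QWalk S p) {h k : ℤ × ℤ → ℝ} (hk : ∀ x, h x ≤ k x) (x : ℤ × ℤ) :
    kill S p h x ≤ kill S p k x := by
  rw [kill_apply, kill_apply]
  split_ifs
  · exact Finset.sum_le_sum fun s hs => mul_le_mul_of_nonneg_left (hk _) (hw.pos s hs).le
  · exact le_rfl

theorem kill_pow_succ (n : ℕ) (h : ℤ × ℤ → ℝ) :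
    (kill S p ^ (n + 1)) h = kill S p ((kill S p ^ n) h) := by
  rw [pow_succ', Module.End.mul_apply]

theorem kill_pow_succ' (n : ℕ) (h : ℤ × ℤ → ℝ) :
    (kill S p ^ (n + 1)) h = (kill S p ^ n) (kill S p h) := by
  rw [pow_succ, Module.End.mul_apply]

theorem kill_pow_mono (hw : QWalk S p) (n : ℕ) {h k : ℤ × ℤ → ℝ} (hk : ∀ x, h x ≤ k x) (x : ℤ × ℤ) :
    (kill S p ^ n) h x ≤ (kill S p ^ n) k x := by
  induction n generalizing x with
  | zero => simpa using hk x
  | succ n ih =>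
    rw [kill_pow_succ, kill_pow_succ]
    exact kill_mono hw ih x

theorem kill_pow_nonneg (hw : QWalk S p) (n : ℕ) {h : ℤ × ℤ → ℝ} (hk : ∀ x, 0 ≤ h x) (x : ℤ × ℤ) :
    0 ≤ (kill S p ^ n) h x := by
  have := kill_pow_mono hw n (h := 0) (k := h) hk x
  simpa using this

theorem NHarm.kill_eq {f : ℤ × ℤ → ℝ} (hf : NHarm S p f) : kill S p f = f := by
  ext x
  rw [kill_apply]
  split_ifs with h
  · exact hf.eq x h
  · exact (hf.zero x h).symm

theorem NHarm.kill_pow_eq {f : ℤ × ℤ → ℝ} (hf : NHarm S p f) (n : ℕ) : (kill S p ^ n) f = f := by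
  induction n with
  | zero => simp
  | succ n ih => rw [kill_pow_succ, ih, hf.kill_eq]

/-- functions whose absolute value is killed asymptotically -/
def Nul (S : Finset (ℤ × ℤ)) (p : ℤ × ℤ → ℝ) (h : ℤ × ℤ → ℝ) : Prop :=
  ∀ x, Tendsto (fun n : ℕ => (kill S p ^ n) (fun y => |h y|) x) atTop (𝓝 0)

theorem Nul.of_le (hw : QWalk S p) {h k : ℤ × ℤ → ℝ} (hk : Nul S p k) (hle : ∀ x, |h x| ≤ |k x|) :
    Nul S p h := fun x =>
  squeeze_zero (fun n => kill_pow_nonneg hw n (fun y => abs_nonneg _) x)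
    (fun n => kill_pow_mono hw n hle x) (hk x)

theorem Nul.add (hw : QWalk S p) {h k : ℤ × ℤ → ℝ} (hh : Nul S p h) (hk : Nul S p k) :
    Nul S p (h + k) := by
  intro x
  have := (hh x).add (hk x)
  rw [add_zero] at this
  refine squeeze_zero (fun n => kill_pow_nonneg hw n (fun y => abs_nonneg _) x) (fun n => ?_) this
  have e := congrFun (map_add (kill S p ^ n) (fun y => |h y|) (fun y => |k y|)) x
  rw [Pi.add_apply] at e
  rw [← e]
  exact kill_pow_mono hw n (fun y => abs_add_le _ _) x

theorem Nul.smul (hw : QWalk S p) {h : ℤ × ℤ → ℝ} (hh : Nul S p h) (c : ℝ) :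
    Nul S p (c • h) := by
  intro x
  have := (hh x).const_mul |c|
  rw [mul_zero] at this
  refine this.congr fun n => ?_
  have e := congrFun (map_smul (kill S p ^ n) |c| (fun y => |h y|)) x
  rw [Pi.smul_apply, smul_eq_mul] at e
  rw [← e]
  have e2 : (fun y => |(c • h) y|) = |c| • (fun y => |h y|) := by
    ext y
    simp [abs_mul]
  rw [e2]

theorem Nul.zero : Nul S p 0 := by
  intro x
  have : (fun y : ℤ × ℤ => |(0 : ℤ × ℤ → ℝ) y|) = 0 := by ext; simp
  rw [this]
  simp

theorem Nul.sum (hw : QWalk S p) {ι : Type*} (T : Finset ι) (F : ι → ℤ × ℤ → ℝ)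
    (hF : ∀ i ∈ T, Nul S p (F i)) : Nul S p (∑ i ∈ T, F i) := by
  classical
  induction T using Finset.induction_on with
  | empty => simpa using Nul.zero
  | insert a T ha ih =>
    rw [Finset.sum_insert ha]
    exact (hF a (Finset.mem_insert_self _ _)).add hw
      (ih fun i hi => hF i (Finset.mem_insert_of_mem hi))

/-- shifted function restricted to the quadrant -/
def shq (s : ℤ × ℤ) (h : ℤ × ℤ → ℝ) : ℤ × ℤ → ℝ := fun x => if InQ x then h (x + s) else 0

theorem shq_pos {s x : ℤ × ℤ} {h : ℤ × ℤ → ℝ} (hx : InQ x) : shq s h x = h (x + s) := if_pos hx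

theorem shq_neg {s x : ℤ × ℤ} {h : ℤ × ℤ → ℝ} (hx : ¬ InQ x) : shq s h x = 0 := if_neg hx

theorem kill_pow_shq (hw : QWalk S p) {u : ℤ × ℤ} (u1 : 0 ≤ u.1) (u2 : 0 ≤ u.2)
    {k : ℤ × ℤ → ℝ} (hk : ∀ x, 0 ≤ k x) (n : ℕ) (x : ℤ × ℤ) :
    (kill S p ^ n) (shq u k) x ≤ shq u ((kill S p ^ n) k) x := by
  induction n generalizing x with
  | zero => simp
  | succ n ih =>
    rw [kill_pow_succ, kill_pow_succ, kill_apply]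
    unfold shq
    split_ifs with hx
    · rw [kill_apply, if_pos (hx.add u1 u2)]
      unfold avg
      refine Finset.sum_le_sum fun s hs => mul_le_mul_of_nonneg_left ?_ (hw.pos s hs).le
      refine (ih (x + s)).trans ?_
      unfold shq
      rw [add_right_comm]
      split_ifs
      · exact le_rfl
      · exact kill_pow_nonneg hw n hk _
    · exact le_rfl

theorem Nul.shq (hw : QWalk S p) {u : ℤ × ℤ} (u1 : 0 ≤ u.1) (u2 : 0 ≤ u.2)
    {h : ℤ × ℤ → ℝ} (hh : Nul S p h) : Nul S p (shq u h) := by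
  intro x
  have e : (fun y => |_root_.shq u h y|) = _root_.shq u (fun y => |h y|) := by
    ext y
    unfold _root_.shq
    split_ifs <;> simp
  rw [e]
  refine squeeze_zero (fun n => kill_pow_nonneg hw n (fun y => ?_) x)
    (fun n => (kill_pow_shq hw u1 u2 (fun y => abs_nonneg _) n x).trans (?_ : _ ≤
      (kill S p ^ n) (fun y => |h y|) (x + u))) (hh (x + u))
  · unfold _root_.shq
    split_ifs <;> positivity
  · unfold _root_.shq
    split_ifs
    · exact le_rfl
    · exact kill_pow_nonneg hw n (fun y => abs_nonneg _) _

theorem shq_shq {u : ℤ × ℤ} (u1 : 0 ≤ u.1) (u2 : 0 ≤ u.2) (s : ℤ × ℤ) (h : ℤ × ℤ → ℝ) :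
    shq u (shq s h) = shq (s + u) h := by
  ext x
  unfold shq
  split_ifs with h1 h2
  · rw [add_assoc, add_comm u s]
  · exact absurd (h1.add u1 u2) h2
  · rfl

/-- extremality -/
def Extr (S : Finset (ℤ × ℤ)) (p : ℤ × ℤ → ℝ) (f : ℤ × ℤ → ℝ) : Prop :=
  ∀ H, NHarm S p H → (∃ C : ℝ, ∀ x, H x ≤ C * f x) → ∃ l : ℝ, 0 ≤ l ∧ H = l • f

theorem limit_harm (hw : QWalk S p) {f h0 H : ℤ × ℤ → ℝ} (hf : NHarm S p f) (h0n : ∀ x, 0 ≤ h0 x)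
    {C : ℝ} (hC : ∀ x, h0 x ≤ C * f x)
    (hlim : ∀ x, Tendsto (fun n : ℕ => (kill S p ^ n) h0 x) atTop (𝓝 (H x))) :
    NHarm S p H ∧ ∀ x, H x ≤ C * f x := by
  have hle : ∀ x, H x ≤ C * f x := by
    intro x
    refine le_of_tendsto' (hlim x) fun n => ?_
    have := kill_pow_mono hw n (h := h0) (k := C • f) hC x
    rw [map_smul, hf.kill_pow_eq] at this
    simpa using this
  have hnn : ∀ x, 0 ≤ H x := fun x =>
    ge_of_tendsto' (hlim x) fun n => kill_pow_nonneg hw n h0n x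
  refine ⟨⟨fun x hx => ?_, hnn, fun x hx => ?_⟩, hle⟩
  · have h1 := (hlim x).comp (tendsto_add_atTop_nat 1)
    have h2 : Tendsto (fun n : ℕ => avg S p ((kill S p ^ n) h0) x) atTop (𝓝 (avg S p H x)) := by
      unfold avg
      exact tendsto_finsetSum _ fun s _ => (hlim (x + s)).const_mul _
    refine tendsto_nhds_unique h2 (h1.congr fun n => ?_)
    simp only [Function.comp_apply]
    rw [kill_pow_succ, kill_apply, if_pos hx]
  · have := hle x
    rw [hf.zero x hx, mul_zero] at this
    exact le_antisymm this (hnn x)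

theorem asym_of_super (hw : QWalk S p) {f h0 : ℤ × ℤ → ℝ} (hf : NHarm S p f) (hE : Extr S p f)
    (h0n : ∀ x, 0 ≤ h0 x) {C : ℝ} (hC : ∀ x, h0 x ≤ C * f x) (hs : ∀ x, kill S p h0 x ≤ h0 x) :
    ∃ l : ℝ, 0 ≤ l ∧ Nul S p (h0 - l • f) ∧ ∀ x, l * f x ≤ h0 x := by
  have anti : ∀ x, Antitone (fun n : ℕ => (kill S p ^ n) h0 x) := by
    intro x
    refine antitone_nat_of_succ_le fun n => ?_
    rw [kill_pow_succ']
    exact kill_pow_mono hw n hs x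
  have hlim : ∀ x, Tendsto (fun n : ℕ => (kill S p ^ n) h0 x) atTop
      (𝓝 (⨅ n : ℕ, (kill S p ^ n) h0 x)) := fun x =>
    tendsto_atTop_ciInf (anti x) ⟨0, by rintro _ ⟨n, rfl⟩; exact kill_pow_nonneg hw n h0n x⟩
  obtain ⟨hH, hle⟩ := limit_harm (H := fun x => ⨅ n : ℕ, (kill S p ^ n) h0 x) hw hf h0n hC hlim
  obtain ⟨l, hl, e⟩ := hE _ hH ⟨C, hle⟩
  have e' : ∀ x, (⨅ n : ℕ, (kill S p ^ n) h0 x) = l * f x := fun x => congrFun e x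
  have hbd : ∀ x, l * f x ≤ h0 x := by
    intro x
    have := (anti x).le_of_tendsto (hlim x) 0
    rw [e'] at this
    simpa using this
  refine ⟨l, hl, fun x => ?_, hbd⟩
  have e2 : (fun y => |(h0 - l • f) y|) = h0 - l • f := by
    ext y
    exact abs_of_nonneg (by simpa using hbd y)
  rw [e2]
  have h3 := (hlim x).sub_const (l * f x)
  rw [e', sub_self] at h3
  refine h3.congr fun n => ?_
  rw [map_sub, map_smul, hf.kill_pow_eq]
  simp

theorem asym_of_sub (hw : QWalk S p) {f h0 : ℤ × ℤ → ℝ} (hf : NHarm S p f) (hE : Extr S p f)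
    (h0n : ∀ x, 0 ≤ h0 x) {C : ℝ} (hC : ∀ x, h0 x ≤ C * f x) (hs : ∀ x, h0 x ≤ kill S p h0 x) :
    ∃ l : ℝ, 0 ≤ l ∧ Nul S p (h0 - l • f) := by
  have anti : ∀ x, Monotone (fun n : ℕ => (kill S p ^ n) h0 x) := by
    intro x
    refine monotone_nat_of_le_succ fun n => ?_
    rw [kill_pow_succ']
    exact kill_pow_mono hw n hs x
  have hlim : ∀ x, Tendsto (fun n : ℕ => (kill S p ^ n) h0 x) atTop
      (𝓝 (⨆ n : ℕ, (kill S p ^ n) h0 x)) := fun x =>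
    tendsto_atTop_ciSup (anti x) ⟨C * f x, by
      rintro _ ⟨n, rfl⟩
      have := kill_pow_mono hw n (h := h0) (k := C • f) hC x
      rw [map_smul, hf.kill_pow_eq] at this
      simpa using this⟩
  obtain ⟨hH, hle⟩ := limit_harm (H := fun x => ⨆ n : ℕ, (kill S p ^ n) h0 x) hw hf h0n hC hlim
  obtain ⟨l, hl, e⟩ := hE _ hH ⟨C, hle⟩
  have e' : ∀ x, (⨆ n : ℕ, (kill S p ^ n) h0 x) = l * f x := fun x => congrFun e x
  have hbd : ∀ x, h0 x ≤ l * f x := by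
    intro x
    have := (anti x).ge_of_tendsto (hlim x) 0
    rw [e'] at this
    simpa using this
  refine ⟨l, hl, fun x => ?_⟩
  have e2 : (fun y => |(h0 - l • f) y|) = l • f - h0 := by
    ext y
    rw [Pi.sub_apply, abs_sub_comm]
    exact abs_of_nonneg (by simpa using hbd y)
  rw [e2]
  have h3 := (hlim x).const_sub (l * f x)
  rw [e', sub_self] at h3
  refine h3.congr fun n => ?_
  rw [map_sub, map_smul, hf.kill_pow_eq]
  simp

/-- asymptotic multiplier of a shift -/
def Asy (S : Finset (ℤ × ℤ)) (p : ℤ × ℤ → ℝ) (f : ℤ × ℤ → ℝ) (s : ℤ × ℤ) (l : ℝ) : Prop :=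
  Nul S p (shq s f - l • f)

theorem nul_smul_eq_zero {f : ℤ × ℤ → ℝ} (hf : NHarm S p f) (h1 : 0 < f (1, 1)) {c : ℝ}
    (h : Nul S p (c • f)) : c = 0 := by
  have := h (1, 1)
  have e : (fun y => |(c • f) y|) = |c| • f := by
    ext y
    simp [abs_mul, abs_of_nonneg (hf.nonneg y)]
  rw [e] at this
  simp only [map_smul, hf.kill_pow_eq] at this
  have h2 := tendsto_nhds_unique this tendsto_const_nhds
  simp only [Pi.smul_apply, smul_eq_mul] at h2
  rcases mul_eq_zero.1 h2.symm with h3 | h3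
  · exact abs_eq_zero.1 h3
  · exact absurd h3 h1.ne'

theorem Asy.unique (hw : QWalk S p) {f : ℤ × ℤ → ℝ} (hf : NHarm S p f) (h1 : 0 < f (1, 1))
    {s : ℤ × ℤ} {l m : ℝ} (hl : Asy S p f s l) (hm : Asy S p f s m) : l = m := by
  have h := (hm.add hw (hl.smul hw (-1)))
  have e : (shq s f - m • f) + (-1 : ℝ) • (shq s f - l • f) = (l - m) • f := by
    ext x
    simp
    ring
  rw [e] at h
  linarith [nul_smul_eq_zero hf h1 h]

theorem Asy.zero {f : ℤ × ℤ → ℝ} (hf : NHarm S p f) : Asy S p f 0 1 := by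
  have : shq 0 f - (1 : ℝ) • f = 0 := by
    ext x
    simp only [shq, add_zero, one_smul, Pi.sub_apply, Pi.zero_apply]
    split_ifs with h
    · ring
    · rw [hf.zero x h]; ring
  unfold Asy
  rw [this]
  exact Nul.zero

theorem Asy.add (hw : QWalk S p) {f : ℤ × ℤ → ℝ} {s u : ℤ × ℤ} (u1 : 0 ≤ u.1) (u2 : 0 ≤ u.2)
    {l m : ℝ} (hl : Asy S p f s l) (hm : Asy S p f u m) : Asy S p f (s + u) (l * m) := by
  have h := (Nul.shq hw u1 u2 hl).add hw (hm.smul hw l)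
  have e : shq u (shq s f - l • f) + l • (shq u f - m • f) = shq (s + u) f - (l * m) • f := by
    rw [← shq_shq u1 u2]
    ext x
    simp only [Pi.add_apply, Pi.sub_apply, Pi.smul_apply, smul_eq_mul]
    by_cases hx : InQ x
    · rw [shq_pos hx, shq_pos hx, shq_pos hx]
      simp only [Pi.sub_apply, Pi.smul_apply, smul_eq_mul]
      ring
    · rw [shq_neg hx, shq_neg hx, shq_neg hx]
      ring
  rw [e] at h
  exact h

theorem Asy.exists_pos_shift (hw : QWalk S p) {f : ℤ × ℤ → ℝ} (hf : NHarm S p f) (h1 : 0 < f (1, 1))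
    (hE : Extr S p f) {u : ℤ × ℤ} (u1 : 0 ≤ u.1) (u2 : 0 ≤ u.2) :
    ∃ l : ℝ, 0 ≤ l ∧ Asy S p f u l ∧ ∀ x, InQ x → l * f x ≤ f (x + u) := by
  have hq : InQ (1, 1) := ⟨le_rfl, le_rfl⟩
  obtain ⟨-, -, c, hc, H⟩ := (comp_all hw hf h1 hq (hq.add u1 u2)).1
  have hb : ∀ x, shq u f x ≤ c⁻¹ * f x := by
    intro x
    unfold shq
    split_ifs with hx
    · have := H f hf (x - (1, 1)) (by simpa using hx.1) (by simpa using hx.2)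
      have e1 : ((1, 1) : ℤ × ℤ) + u + (x - (1, 1)) = x + u := by abel
      have e2 : ((1, 1) : ℤ × ℤ) + (x - (1, 1)) = x := by abel
      rw [e1, e2] at this
      rw [inv_mul_eq_div, le_div_iff₀ hc]
      linarith
    · have := hf.nonneg x
      positivity
  have hn : ∀ x, 0 ≤ shq u f x := by
    intro x
    unfold shq
    split_ifs
    · exact hf.nonneg _
    · exact le_rfl
  have hs : ∀ x, kill S p (shq u f) x ≤ shq u f x := by
    intro x
    have := kill_pow_shq hw u1 u2 hf.nonneg 1 x
    rw [pow_one, hf.kill_eq] at this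
    exact this
  obtain ⟨l, hl, h2, h3⟩ := asym_of_super hw hf hE hn hb hs
  refine ⟨l, hl, h2, fun x hx => ?_⟩
  have := h3 x
  unfold shq at this
  rwa [if_pos hx] at this

theorem Asy.exists_neg_shift (hw : QWalk S p) {f : ℤ × ℤ → ℝ} (hf : NHarm S p f) (h1 : 0 < f (1, 1))
    (hE : Extr S p f) {u : ℤ × ℤ} (u1 : 0 ≤ u.1) (u2 : 0 ≤ u.2) :
    ∃ l : ℝ, 0 ≤ l ∧ Asy S p f (-u) l := by
  have hq : InQ (1, 1) := ⟨le_rfl, le_rfl⟩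
  obtain ⟨-, -, c, hc, H⟩ := (comp_all hw hf h1 hq (hq.add u1 u2)).2
  have hQ : ∀ x, InQ (x + -u) → InQ x := by
    intro x hx
    have := hx.add u1 u2
    simpa using this
  have e0 : ∀ x, shq (-u) f x = f (x + -u) := by
    intro x
    unfold shq
    split_ifs with hx
    · rfl
    · exact (hf.zero _ fun h => hx (hQ x h)).symm
  have hb : ∀ x, shq (-u) f x ≤ c⁻¹ * f x := by
    intro x
    rw [e0]
    by_cases hx : InQ (x + -u)
    · have := H f hf (x + -u - (1, 1)) (by have := hx.1; simp only [Prod.fst_sub]; omega)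
        (by have := hx.2; simp only [Prod.snd_sub]; omega)
      have e1 : ((1, 1) : ℤ × ℤ) + u + (x + -u - (1, 1)) = x := by abel
      have e2 : ((1, 1) : ℤ × ℤ) + (x + -u - (1, 1)) = x + -u := by abel
      rw [e1, e2] at this
      rw [inv_mul_eq_div, le_div_iff₀ hc]
      linarith
    · rw [hf.zero _ hx]
      have := hf.nonneg x
      positivity
  have hn : ∀ x, 0 ≤ shq (-u) f x := by
    intro x
    rw [e0]
    exact hf.nonneg _
  have hs : ∀ x, shq (-u) f x ≤ kill S p (shq (-u) f) x := by
    intro x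
    by_cases hx : InQ (x + -u)
    · rw [kill_apply, if_pos (hQ x hx), e0, ← hf.eq _ hx]
      unfold avg
      refine le_of_eq (Finset.sum_congr rfl fun s _ => ?_)
      rw [e0, add_right_comm]
    · rw [e0, hf.zero _ hx, kill_apply]
      split_ifs
      · exact Finset.sum_nonneg fun s hs => mul_nonneg (hw.pos s hs).le (hn _)
      · exact le_rfl
  exact asym_of_sub hw hf hE hn hb hs

theorem Asy.exists_multiplier (hw : QWalk S p) {f : ℤ × ℤ → ℝ} (hf : NHarm S p f)
    (h1 : 0 < f (1, 1)) (hE : Extr S p f) :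
    ∃ a b : ℝ, 0 < a ∧ 0 < b ∧ ∀ s : ℤ × ℤ, Asy S p f s (a ^ s.1 * b ^ s.2) := by
  have inv : ∀ u : ℤ × ℤ, 0 ≤ u.1 → 0 ≤ u.2 → ∀ l, 0 ≤ l → Asy S p f u l →
      0 < l ∧ Asy S p f (-u) l⁻¹ := by
    intro u u1 u2 l hl hA
    obtain ⟨m, hm, hB⟩ := Asy.exists_neg_shift hw hf h1 hE u1 u2
    have h3 := hB.add hw u1 u2 hA
    rw [neg_add_cancel] at h3
    have h4 := h3.unique hw hf h1 (Asy.zero hf)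
    have hl0 : l ≠ 0 := by rintro rfl; simp at h4
    refine ⟨lt_of_le_of_ne hl hl0.symm, ?_⟩
    rwa [eq_inv_of_mul_eq_one_left h4] at hB
  obtain ⟨a, ha0, ha, -⟩ := Asy.exists_pos_shift hw hf h1 hE (u := (1, 0)) (by simp) (by simp)
  obtain ⟨b, hb0, hb, -⟩ := Asy.exists_pos_shift hw hf h1 hE (u := (0, 1)) (by simp) (by simp)
  have ha1 := (inv _ (by simp) (by simp) a ha0 ha).1
  have hb1 := (inv _ (by simp) (by simp) b hb0 hb).1
  have hA : ∀ n : ℕ, Asy S p f ((n : ℤ), 0) (a ^ n) := by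
    intro n
    induction n with
    | zero => simpa [← Prod.zero_eq_mk] using Asy.zero hf
    | succ n ih =>
      have := ih.add hw (by simp) (by simp) ha
      rw [pow_succ]
      simpa using this
  have hB : ∀ n : ℕ, Asy S p f (0, (n : ℤ)) (b ^ n) := by
    intro n
    induction n with
    | zero => simpa [← Prod.zero_eq_mk] using Asy.zero hf
    | succ n ih =>
      have := ih.add hw (by simp) (by simp) hb
      rw [pow_succ]
      simpa using this
  have hAB : ∀ n m : ℕ, Asy S p f ((n : ℤ), (m : ℤ)) (a ^ n * b ^ m) := by
    intro n m
    have := (hA n).add hw (by simp) (by simp) (hB m)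
    simpa using this
  refine ⟨a, b, ha1, hb1, fun s => ?_⟩
  have h2 := (inv _ (by simp) (by simp) _ (by positivity) (hAB (-s.1).toNat (-s.2).toNat)).2
  have h3 := h2.add hw (by simp) (by simp) (hAB s.1.toNat s.2.toNat)
  have e1 : -((((-s.1).toNat : ℕ) : ℤ), (((-s.2).toNat : ℕ) : ℤ)) +
      (((s.1.toNat : ℕ) : ℤ), ((s.2.toNat : ℕ) : ℤ)) = s := by
    ext
    · simp only [Prod.fst_add, Prod.fst_neg]; omega
    · simp only [Prod.snd_add, Prod.snd_neg]; omega
  have e2 : ∀ c : ℝ, 0 < c → ∀ k : ℤ, c ^ k = (c ^ (-k).toNat)⁻¹ * c ^ k.toNat := by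
    intro c hc k
    rw [← zpow_natCast, ← zpow_natCast, ← zpow_neg, ← zpow_add₀ hc.ne']
    congr 1
    omega
  rw [e1] at h3
  rw [e2 a ha1, e2 b hb1]
  convert h3 using 1
  rw [mul_inv]
  ring

theorem sum_neg_eq (hw : QWalk S p) (F : ℤ × ℤ → ℝ) : ∑ s ∈ S, F (-s) = ∑ s ∈ S, F s :=
  Finset.sum_nbij' (fun s => -s) (fun s => -s) (fun s hs => hw.neg_mem s hs)
    (fun s hs => hw.neg_mem s hs) (by simp) (by simp) (by simp)

theorem multiplier_eq_one (hw : QWalk S p) {f : ℤ × ℤ → ℝ} (hf : NHarm S p f)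
    (h1 : 0 < f (1, 1)) {a b : ℝ} (ha : 0 < a) (hb : 0 < b)
    (H : ∀ s : ℤ × ℤ, Asy S p f s (a ^ s.1 * b ^ s.2)) : a = 1 ∧ b = 1 := by
  have hN := Nul.sum hw S (fun s => p s • (shq s f - (a ^ s.1 * b ^ s.2) • f))
    (fun s _ => (H s).smul hw _)
  have e : ∑ s ∈ S, p s • (shq s f - (a ^ s.1 * b ^ s.2) • f) =
      (1 - ∑ s ∈ S, p s * (a ^ s.1 * b ^ s.2)) • f := by
    ext x
    simp only [Finset.sum_apply, Pi.smul_apply, Pi.sub_apply, smul_eq_mul]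
    by_cases hx : InQ x
    · have e1 := hf.eq x hx
      unfold avg at e1
      rw [sub_mul, one_mul, Finset.sum_mul]
      have e3 : f x - ∑ i ∈ S, p i * (a ^ i.1 * b ^ i.2) * f x =
          ∑ s ∈ S, p s * f (x + s) - ∑ i ∈ S, p i * (a ^ i.1 * b ^ i.2) * f x := by rw [e1]
      rw [e3, ← Finset.sum_sub_distrib]
      refine Finset.sum_congr rfl fun s _ => ?_
      rw [shq_pos hx]
      ring
    · rw [hf.zero x hx, mul_zero]
      refine Finset.sum_eq_zero fun s _ => ?_
      rw [shq_neg hx]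
      ring
  rw [e] at hN
  have h2 : ∑ s ∈ S, p s * (a ^ s.1 * b ^ s.2) = 1 := by
    linarith [nul_smul_eq_zero hf h1 hN]
  have h3 : ∑ s ∈ S, p s * (a ^ s.1 * b ^ s.2)⁻¹ = 1 := by
    rw [← h2, ← sum_neg_eq hw (fun s => p s * (a ^ s.1 * b ^ s.2))]
    refine Finset.sum_congr rfl fun s _ => ?_
    simp [hw.symm, mul_comm]
  have hpos : ∀ s : ℤ × ℤ, 0 < a ^ s.1 * b ^ s.2 := fun s => by positivity
  have key : ∀ l : ℝ, 0 < l → l + l⁻¹ - 2 = (l - 1) ^ 2 / l := by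
    intro l hl
    field_simp
    ring
  have h4 : ∑ s ∈ S, p s * (a ^ s.1 * b ^ s.2 + (a ^ s.1 * b ^ s.2)⁻¹ - 2) = 0 := by
    have : ∀ s, p s * (a ^ s.1 * b ^ s.2 + (a ^ s.1 * b ^ s.2)⁻¹ - 2) =
      p s * (a ^ s.1 * b ^ s.2) + p s * (a ^ s.1 * b ^ s.2)⁻¹ - 2 * p s := fun s => by ring
    simp only [this]
    rw [Finset.sum_sub_distrib, Finset.sum_add_distrib, h2, h3, ← Finset.mul_sum, hw.sum]
    norm_num
  rw [Finset.sum_eq_zero_iff_of_nonneg] at h4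
  · have h5 : ∀ s ∈ S, a ^ s.1 * b ^ s.2 = 1 := by
      intro s hs
      have h6 := h4 s hs
      rw [key _ (hpos s)] at h6
      rcases mul_eq_zero.1 h6 with h7 | h7
      · exact absurd h7 (hw.pos s hs).ne'
      · rcases div_eq_zero_iff.1 h7 with h8 | h8
        · have := pow_eq_zero_iff (two_ne_zero) |>.1 h8
          linarith
        · exact absurd h8 (hpos s).ne'
    have h6 : ∀ z : ℤ × ℤ, a ^ z.1 * b ^ z.2 = 1 := by
      intro z
      have hz : z ∈ AddSubgroup.closure (S : Set (ℤ × ℤ)) := by rw [hw.gen]; trivial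
      induction hz using AddSubgroup.closure_induction with
      | mem s hs => exact h5 s hs
      | zero => simp
      | add x y _ _ hx hy =>
        rw [Prod.fst_add, Prod.snd_add, zpow_add₀ ha.ne', zpow_add₀ hb.ne']
        calc _ = (a ^ x.1 * b ^ x.2) * (a ^ y.1 * b ^ y.2) := by ring
          _ = 1 := by rw [hx, hy, one_mul]
      | neg x _ hx =>
        rw [Prod.fst_neg, Prod.snd_neg, zpow_neg, zpow_neg, ← mul_inv, hx, inv_one]
    have h7 := h6 (1, 0)
    have h8 := h6 (0, 1)
    simp at h7 h8
    exact ⟨h7, h8⟩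
  · intro s hs
    rw [key _ (hpos s)]
    have := hpos s
    have := (hw.pos s hs).le
    positivity

/-- monotone functions on the quadrant -/
def MonoQ (f : ℤ × ℤ → ℝ) : Prop :=
  ∀ x u : ℤ × ℤ, InQ x → 0 ≤ u.1 → 0 ≤ u.2 → f x ≤ f (x + u)

theorem extr_mono (hw : QWalk S p) {f : ℤ × ℤ → ℝ} (hf : NHarm S p f)
    (h1 : 0 < f (1, 1)) (hE : Extr S p f) : MonoQ f := by
  intro x u hx u1 u2
  obtain ⟨a, b, ha, hb, H⟩ := Asy.exists_multiplier hw hf h1 hE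
  obtain ⟨rfl, rfl⟩ := multiplier_eq_one hw hf h1 ha hb H
  obtain ⟨l, -, hA, hl⟩ := Asy.exists_pos_shift hw hf h1 hE u1 u2
  have := hA.unique hw hf h1 (H u)
  have h3 := hl x hx
  rw [this] at h3
  simpa using h3

/-- normalised harmonic functions -/
def harmSet (S : Finset (ℤ × ℤ)) (p : ℤ × ℤ → ℝ) : Set (ℤ × ℤ → ℝ) :=
  {h | NHarm S p h ∧ h (1, 1) = 1}

theorem avg_add (h k : ℤ × ℤ → ℝ) (x : ℤ × ℤ) : avg S p (h + k) x = avg S p h x + avg S p k x := by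
  simp [avg, mul_add, Finset.sum_add_distrib]

theorem avg_smul (c : ℝ) (h : ℤ × ℤ → ℝ) (x : ℤ × ℤ) : avg S p (c • h) x = c * avg S p h x := by
  simp only [avg, Pi.smul_apply, smul_eq_mul, Finset.mul_sum]
  exact Finset.sum_congr rfl fun s _ => by ring

theorem NHarm.comb {h k : ℤ × ℤ → ℝ} (hh : NHarm S p h) (hk : NHarm S p k) {a b : ℝ}
    (hn : ∀ x, 0 ≤ a * h x + b * k x) : NHarm S p (a • h + b • k) := by
  refine ⟨fun x hx => ?_, fun x => by simpa using hn x, fun x hx => ?_⟩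
  · rw [avg_add, avg_smul, avg_smul, hh.eq x hx, hk.eq x hx]
    simp
  · simp [hh.zero x hx, hk.zero x hx]

theorem harmSet_convex : Convex ℝ (harmSet S p) := by
  rintro h ⟨hh, h1⟩ k ⟨hk, k1⟩ a b ha hb hab
  refine ⟨hh.comb hk fun x => ?_, by simp [h1, k1, hab]⟩
  have := hh.nonneg x
  have := hk.nonneg x
  positivity

theorem harmSet_compact (hw : QWalk S p) {f : ℤ × ℤ → ℝ} (hf : NHarm S p f)
    (h1 : 0 < f (1, 1)) : IsCompact (harmSet S p) := by
  have hq : InQ (1, 1) := ⟨le_rfl, le_rfl⟩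
  have hb : ∀ x, ∃ C : ℝ, ∀ h ∈ harmSet S p, h x ∈ Set.Icc 0 C := by
    intro x
    by_cases hx : InQ x
    · obtain ⟨-, -, c, hc, H⟩ := (comp_all hw hf h1 hq hx).1
      refine ⟨c⁻¹, fun h hh => ⟨hh.1.nonneg x, ?_⟩⟩
      have := H h hh.1 0 le_rfl le_rfl
      rw [add_zero, add_zero, hh.2] at this
      rw [inv_eq_one_div, le_div_iff₀ hc]
      linarith
    · exact ⟨0, fun h hh => by simp [hh.1.zero x hx]⟩
  choose C hC using hb
  have hsub : harmSet S p ⊆ Set.pi Set.univ (fun x => Set.Icc 0 (C x)) :=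
    fun h hh x _ => hC x h hh
  refine IsCompact.of_isClosed_subset (isCompact_univ_pi fun x => isCompact_Icc) ?_ hsub
  have e : harmSet S p = (⋂ x, ⋂ (_ : InQ x), {h | avg S p h x = h x}) ∩ (⋂ x, {h | 0 ≤ h x}) ∩
      (⋂ x, ⋂ (_ : ¬ InQ x), {h | h x = 0}) ∩ {h | h (1, 1) = 1} := by
    ext h
    simp only [harmSet, Set.mem_ofPred_eq, Set.mem_inter_iff, Set.mem_iInter]
    exact ⟨fun ⟨⟨a, b, c⟩, d⟩ => ⟨⟨⟨a, b⟩, c⟩, d⟩, fun ⟨⟨⟨a, b⟩, c⟩, d⟩ => ⟨⟨a, b, c⟩, d⟩⟩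
  rw [e]
  have cx : ∀ x : ℤ × ℤ, Continuous fun h : ℤ × ℤ → ℝ => h x := fun x => continuous_apply x
  refine ((IsClosed.inter ?_ ?_).inter ?_).inter ?_
  · refine isClosed_iInter fun x => isClosed_iInter fun _ => isClosed_eq ?_ (cx x)
    unfold avg
    exact continuous_finsetSum _ fun s _ => (cx _).const_mul _
  · exact isClosed_iInter fun x => isClosed_le continuous_const (cx x)
  · exact isClosed_iInter fun x => isClosed_iInter fun _ => isClosed_eq (cx x) continuous_const
  · exact isClosed_eq (cx _) continuous_const

theorem NHarm.eq_zero_of (hw : QWalk S p) {f h : ℤ × ℤ → ℝ} (hf : NHarm S p f)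
    (h1 : 0 < f (1, 1)) (hh : NHarm S p h) {y : ℤ × ℤ} (hy : InQ y) (h0 : h y = 0) : h = 0 := by
  ext x
  by_cases hx : InQ x
  · obtain ⟨-, -, c, hc, H⟩ := (comp_all hw hf h1 hy hx).1
    have := H h hh 0 le_rfl le_rfl
    rw [add_zero, add_zero, h0] at this
    have h2 := hh.nonneg x
    have : h x ≤ 0 := by
      by_contra hcon
      push Not at hcon
      have := mul_pos hc hcon
      linarith
    exact le_antisymm this h2
  · exact hh.zero x hx

theorem extr_of_extreme (hw : QWalk S p) {f : ℤ × ℤ → ℝ}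
    (hf : f ∈ (harmSet S p).extremePoints ℝ) : Extr S p f := by
  rw [mem_extremePoints_iff_left] at hf
  obtain ⟨⟨hh, h1⟩, hext⟩ := hf
  have hq : InQ (1, 1) := ⟨le_rfl, le_rfl⟩
  rintro H hH ⟨C, hC⟩
  rcases (hH.nonneg (1, 1)).lt_or_eq with ha | ha
  · set a := H (1, 1) with hadef
    have haC : a ≤ C := by
      have := hC (1, 1)
      rwa [h1, mul_one] at this
    have hCpos : 0 < C := ha.trans_le haC
    have hth : 0 < a / (2 * C) := by positivity
    have hth1 : a / (2 * C) < 1 := by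
      rw [div_lt_one (by positivity)]
      linarith
    have hth2 : 0 < 1 - a / (2 * C) := by linarith
    have hH1 : a⁻¹ • H ∈ harmSet S p := by
      refine ⟨?_, ?_⟩
      · have := hH.comb hH (a := a⁻¹) (b := 0) (fun x => by
          have := hH.nonneg x
          positivity)
        simpa using this
      · simp [← hadef, ha.ne']
    have hG : (1 - a / (2 * C))⁻¹ • f + (-((1 - a / (2 * C))⁻¹ * (2 * C)⁻¹)) • H ∈ harmSet S p := by
      refine ⟨hh.comb hH fun x => ?_, ?_⟩
      · have e : (1 - a / (2 * C))⁻¹ * f x + -((1 - a / (2 * C))⁻¹ * (2 * C)⁻¹) * H x =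
          (1 - a / (2 * C))⁻¹ * (f x - (2 * C)⁻¹ * H x) := by ring
        rw [e]
        refine mul_nonneg (inv_nonneg.2 hth2.le) ?_
        have h3 := hC x
        have h4 := hh.nonneg x
        rw [sub_nonneg, inv_mul_eq_div, div_le_iff₀ (by positivity)]
        nlinarith
      · simp only [Pi.add_apply, Pi.smul_apply, smul_eq_mul, h1, ← hadef]
        have e : (1 - a / (2 * C))⁻¹ * 1 + -((1 - a / (2 * C))⁻¹ * (2 * C)⁻¹) * a =
          (1 - a / (2 * C))⁻¹ * (1 - a / (2 * C)) := by
          rw [div_eq_mul_inv]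
          ring
        rw [e, inv_mul_cancel₀ hth2.ne']
    have h5 := hext _ hH1 _ hG ⟨a / (2 * C), 1 - a / (2 * C), hth, hth2, by ring, by
      ext x
      simp only [Pi.add_apply, Pi.smul_apply, smul_eq_mul]
      generalize hT : 1 - a / (2 * C) = T at hth2
      have i1 : T * T⁻¹ = 1 := mul_inv_cancel₀ hth2.ne'
      have i2 : a * a⁻¹ = 1 := mul_inv_cancel₀ ha.ne'
      rw [div_eq_mul_inv]
      linear_combination (f x - (2 * C)⁻¹ * H x) * i1 + (2 * C)⁻¹ * H x * i2⟩
    refine ⟨a, ha.le, ?_⟩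
    rw [← h5, smul_smul, mul_inv_cancel₀ ha.ne', one_smul]
  · refine ⟨0, le_rfl, ?_⟩
    rw [zero_smul]
    exact hh.eq_zero_of hw (by rw [h1]; exact one_pos) hH hq ha.symm

theorem harm_mono (hw : QWalk S p) {f : ℤ × ℤ → ℝ} (hf : NHarm S p f)
    (h1 : 0 < f (1, 1)) : MonoQ f := by
  have hK := closure_convexHull_extremePoints (harmSet_compact hw hf h1) harmSet_convex
  have hcl : IsClosed {h : ℤ × ℤ → ℝ | MonoQ h} := by
    simp only [MonoQ, Set.ofPred_forall]
    refine isClosed_iInter fun x => isClosed_iInter fun u => isClosed_iInter fun _ =>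
      isClosed_iInter fun _ => isClosed_iInter fun _ =>
      isClosed_le (continuous_apply _) (continuous_apply _)
  have hcv : Convex ℝ {h : ℤ × ℤ → ℝ | MonoQ h} := by
    intro h hh k hk a b ha hb hab x u hx u1 u2
    have e1 := hh x u hx u1 u2
    have e2 := hk x u hx u1 u2
    simp only [Pi.add_apply, Pi.smul_apply, smul_eq_mul]
    gcongr
  have hsub : harmSet S p ⊆ {h | MonoQ h} := by
    rw [← hK]
    refine closure_minimal (convexHull_min (fun h hh => ?_) hcv) hcl
    have hm := (extremePoints_subset hh)
    exact extr_mono hw hm.1 (by rw [hm.2]; exact one_pos) (extr_of_extreme hw hh)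
  have hmem : (f (1, 1))⁻¹ • f ∈ harmSet S p := by
    refine ⟨?_, by simp [h1.ne']⟩
    have := hf.comb hf (a := (f (1, 1))⁻¹) (b := 0) (fun x => by
      have := hf.nonneg x
      positivity)
    simpa using this
  intro x u hx u1 u2
  have := hsub hmem x u hx u1 u2
  simp only [Pi.smul_apply, smul_eq_mul] at this
  exact le_of_mul_le_mul_left this (inv_pos.2 h1)

end Mono
section Barrier

variable {S : Finset (ℤ × ℤ)} {p : ℤ × ℤ → ℝ}

theorem sum_fst_zero (hw : QWalk S p) : ∑ s ∈ S, p s * (s.1 : ℝ) = 0 := by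
  have := sum_neg_eq hw (fun s => p s * (s.1 : ℝ))
  simp only [hw.symm, Prod.fst_neg, Int.cast_neg, mul_neg, Finset.sum_neg_distrib] at this
  linarith

theorem sum_snd_zero (hw : QWalk S p) : ∑ s ∈ S, p s * (s.2 : ℝ) = 0 := by
  have := sum_neg_eq hw (fun s => p s * (s.2 : ℝ))
  simp only [hw.symm, Prod.snd_neg, Int.cast_neg, mul_neg, Finset.sum_neg_distrib] at this
  linarith

/-- second moments -/
noncomputable def var1 (S : Finset (ℤ × ℤ)) (p : ℤ × ℤ → ℝ) : ℝ := ∑ s ∈ S, p s * (s.1 : ℝ) ^ 2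

/-- second moments -/
noncomputable def var2 (S : Finset (ℤ × ℤ)) (p : ℤ × ℤ → ℝ) : ℝ := ∑ s ∈ S, p s * (s.2 : ℝ) ^ 2

theorem var1_pos (hw : QWalk S p) : 0 < var1 S p := by
  obtain ⟨r, hr, hr1⟩ := exists_fst_pos hw
  refine Finset.sum_pos' (fun s hs => mul_nonneg (hw.pos s hs).le (sq_nonneg _)) ⟨r, hr, ?_⟩
  have : (0 : ℝ) < r.1 := by exact_mod_cast hr1
  have := hw.pos r hr
  positivity

theorem var2_pos (hw : QWalk S p) : 0 < var2 S p := by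
  obtain ⟨r, hr, hr1⟩ := exists_snd_pos hw
  refine Finset.sum_pos' (fun s hs => mul_nonneg (hw.pos s hs).le (sq_nonneg _)) ⟨r, hr, ?_⟩
  have : (0 : ℝ) < r.2 := by exact_mod_cast hr1
  have := hw.pos r hr
  positivity

theorem avg_quad (hw : QWalk S p) (a b c d e : ℝ) (x : ℤ × ℤ) :
    avg S p (fun x => a + b * x.1 + c * (x.1 : ℝ) ^ 2 + d * ((x.2 : ℝ) - e) ^ 2) x =
      a + b * x.1 + c * (x.1 : ℝ) ^ 2 + d * ((x.2 : ℝ) - e) ^ 2 + c * var1 S p + d * var2 S p := by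
  unfold avg var1 var2
  have h : ∀ s ∈ S, p s * (a + b * ((x + s).1 : ℤ) + c * (((x + s).1 : ℤ) : ℝ) ^ 2 +
      d * ((((x + s).2 : ℤ) : ℝ) - e) ^ 2) =
      p s * (a + b * x.1 + c * (x.1 : ℝ) ^ 2 + d * ((x.2 : ℝ) - e) ^ 2) +
      (b + 2 * c * x.1) * (p s * (s.1 : ℝ)) + (2 * d * (x.2 - e)) * (p s * (s.2 : ℝ)) +
      c * (p s * (s.1 : ℝ) ^ 2) + d * (p s * (s.2 : ℝ) ^ 2) := by
    intro s _
    push_cast [Prod.fst_add, Prod.snd_add]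
    ring
  rw [Finset.sum_congr rfl h]
  simp only [Finset.sum_add_distrib]
  rw [← Finset.sum_mul, ← Finset.mul_sum, ← Finset.mul_sum, ← Finset.mul_sum, ← Finset.mul_sum,
    hw.sum, sum_fst_zero hw, sum_snd_zero hw]
  ring

theorem MonoQ.le {f : ℤ × ℤ → ℝ} (hf : MonoQ f) {x y : ℤ × ℤ} (hx : InQ x) (h1 : x.1 ≤ y.1)
    (h2 : x.2 ≤ y.2) : f x ≤ f y := by
  have := hf x (y - x) hx (by simpa using h1) (by simpa using h2)
  simpa using this

theorem avg_sub' (h k : ℤ × ℤ → ℝ) (a b : ℝ) (x : ℤ × ℤ) :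
    avg S p (fun x => a * h x - b * k x) x = a * avg S p h x - b * avg S p k x := by
  unfold avg
  rw [Finset.mul_sum, Finset.mul_sum, ← Finset.sum_sub_distrib]
  exact Finset.sum_congr rfl fun s _ => by ring

theorem barrier_lower (hw : QWalk S p) {J K n : ℤ} (hJ : ∀ s ∈ S, |s.1| ≤ J ∧ |s.2| ≤ J)
    (hJ1 : 1 ≤ J) (hK : 2 ≤ K)
    (hK2 : 2 * var2 S p ≤ (K : ℝ) ^ 2 * var1 S p) (hn : J ≤ n)
    {g : ℤ × ℤ → ℝ} (hg : NHarm S p g) (hm : MonoQ g) {i j : ℤ} (hi : 1 ≤ i) (hin : i ≤ n)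
    (hj : 2 * K * n ≤ j) : (i : ℝ) * g (n, n) ≤ 6 * n * g (i, j) := by
  have hKn : 2 * n ≤ K * n := by nlinarith
  have hnR : (1 : ℝ) ≤ n := by exact_mod_cast (by omega : (1 : ℤ) ≤ n)
  have hKR : (2 : ℝ) ≤ K := by exact_mod_cast hK
  have hiR : (1 : ℝ) ≤ i := by exact_mod_cast hi
  have hinR : (i : ℝ) ≤ n := by exact_mod_cast hin
  have hG : 0 ≤ g (n, n) := hg.nonneg _
  have hnQ : InQ (n, n) := ⟨by show 1 ≤ n; omega, by show 1 ≤ n; omega⟩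
  rcases hin.lt_or_eq with hlt | rfl
  swap
  · have : g (i, i) ≤ g (i, j) := hm.le hnQ le_rfl (by show i ≤ j; nlinarith)
    nlinarith [hg.nonneg (i, j)]
  set G := g (n, n) with hGdef
  have key := max_principle hw (Finset.Ioo 0 n ×ˢ Finset.Ioo (K * n) (3 * K * n))
    (fun x => (6 * (n : ℝ) ^ 2 * K ^ 2) * g x - G *
      (0 + ((K : ℝ) ^ 2 * n) * x.1 + (K : ℝ) ^ 2 * (x.1 : ℝ) ^ 2 +
        (-2) * ((x.2 : ℝ) - 2 * K * n) ^ 2)) ?_ ?_ (i, 2 * K * n) ?_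
  · have hle : g (i, 2 * K * n) ≤ g (i, j) :=
      hm.le ⟨hi, by show 1 ≤ 2 * K * n; nlinarith⟩ le_rfl hj
    simp only at key
    push_cast at key
    have h2 : G * ((K : ℝ) ^ 2 * n * i) ≤ 6 * (n : ℝ) ^ 2 * K ^ 2 * g (i, 2 * K * n) := by
      have : 0 ≤ G * ((K : ℝ) ^ 2 * i ^ 2) := by positivity
      nlinarith
    have h3 : ((K : ℝ) ^ 2 * n) * (i * G) ≤ ((K : ℝ) ^ 2 * n) * (6 * n * g (i, 2 * K * n)) := by
      nlinarith
    have h4 := le_of_mul_le_mul_left h3 (by positivity)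
    have : 6 * (n : ℝ) * g (i, 2 * K * n) ≤ 6 * n * g (i, j) := by gcongr
    linarith
  · intro x hx
    simp only [Finset.mem_product, Finset.mem_Ioo] at hx
    obtain ⟨⟨x1, x2⟩, x3, x4⟩ := hx
    rw [avg_sub', avg_quad hw, hg.eq x ⟨by omega, by omega⟩]
    have : 0 ≤ G * ((K : ℝ) ^ 2 * var1 S p - 2 * var2 S p) := mul_nonneg hG (by linarith)
    nlinarith
  · intro x hx s hs hy
    simp only [Finset.mem_product, Finset.mem_Ioo] at hx
    obtain ⟨⟨x1, x2⟩, x3, x4⟩ := hx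
    obtain ⟨s1, s2⟩ := hJ s hs
    rw [abs_le] at s1 s2
    have y1 : -n ≤ (x + s).1 := by simp only [Prod.fst_add]; omega
    have y2 : (x + s).1 ≤ 2 * n := by simp only [Prod.fst_add]; omega
    have y3 : n ≤ (x + s).2 := by simp only [Prod.snd_add]; omega
    generalize x + s = y at hy y1 y2 y3
    have y1R : -(n : ℝ) ≤ y.1 := by exact_mod_cast y1
    have y2R : (y.1 : ℝ) ≤ 2 * n := by exact_mod_cast y2
    have hgy := hg.nonneg y
    rw [sub_nonneg]
    by_cases c1 : n ≤ y.1
    · have h1 : G ≤ g y := hm.le hnQ c1 y3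
      have c1R : (n : ℝ) ≤ y.1 := by exact_mod_cast c1
      have hv : 0 + ((K : ℝ) ^ 2 * n) * y.1 + (K : ℝ) ^ 2 * (y.1 : ℝ) ^ 2 +
        (-2) * ((y.2 : ℝ) - 2 * K * n) ^ 2 ≤ 6 * (n : ℝ) ^ 2 * K ^ 2 := by
        have : n * (y.1 : ℝ) + (y.1 : ℝ) ^ 2 ≤ 6 * n ^ 2 := by nlinarith
        have h5 : (K : ℝ) ^ 2 * (n * (y.1 : ℝ) + (y.1 : ℝ) ^ 2) ≤ K ^ 2 * (6 * n ^ 2) := by gcongr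
        nlinarith [sq_nonneg ((y.2 : ℝ) - 2 * K * n)]
      calc _ ≤ G * (6 * (n : ℝ) ^ 2 * K ^ 2) := by gcongr
        _ ≤ g y * (6 * (n : ℝ) ^ 2 * K ^ 2) := by gcongr
        _ = _ := by ring
    · have hv : 0 + ((K : ℝ) ^ 2 * n) * y.1 + (K : ℝ) ^ 2 * (y.1 : ℝ) ^ 2 +
        (-2) * ((y.2 : ℝ) - 2 * K * n) ^ 2 ≤ 0 := by
        push Not at c1
        have c1R : (y.1 : ℝ) ≤ n := by exact_mod_cast c1.le
        by_cases c2 : y.1 ≤ 0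
        · have c2R : (y.1 : ℝ) ≤ 0 := by exact_mod_cast c2
          have : n * (y.1 : ℝ) + (y.1 : ℝ) ^ 2 ≤ 0 := by nlinarith
          have h5 : (K : ℝ) ^ 2 * (n * (y.1 : ℝ) + (y.1 : ℝ) ^ 2) ≤ 0 :=
            mul_nonpos_of_nonneg_of_nonpos (by positivity) this
          nlinarith [sq_nonneg ((y.2 : ℝ) - 2 * K * n)]
        · push Not at c2
          have c2R : (0 : ℝ) ≤ y.1 := by exact_mod_cast c2.le
          have c3 : y.2 ≤ K * n ∨ 3 * K * n ≤ y.2 := by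
            by_contra hcon
            push Not at hcon
            exact hy (by simp only [Finset.mem_product, Finset.mem_Ioo]; exact ⟨⟨c2, c1⟩, hcon⟩)
          have hsq : ((K : ℝ) * n) ^ 2 ≤ ((y.2 : ℝ) - 2 * K * n) ^ 2 := by
            have hp : (0 : ℝ) ≤ K * n := by positivity
            rcases c3 with c3 | c3
            · have c3R : (y.2 : ℝ) ≤ K * n := by exact_mod_cast c3
              nlinarith
            · have c3R : 3 * (K : ℝ) * n ≤ y.2 := by exact_mod_cast c3
              nlinarith
          have : n * (y.1 : ℝ) + (y.1 : ℝ) ^ 2 ≤ 2 * n ^ 2 := by nlinarith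
          have h5 : (K : ℝ) ^ 2 * (n * (y.1 : ℝ) + (y.1 : ℝ) ^ 2) ≤ K ^ 2 * (2 * n ^ 2) := by gcongr
          nlinarith
      calc _ ≤ 0 := mul_nonpos_of_nonneg_of_nonpos hG hv
        _ ≤ _ := by positivity
  · simp only [Finset.mem_product, Finset.mem_Ioo]
    refine ⟨⟨by omega, hlt⟩, by nlinarith, by nlinarith⟩

theorem barrier_upper (hw : QWalk S p) {J K n : ℤ} (hJ : ∀ s ∈ S, |s.1| ≤ J ∧ |s.2| ≤ J)
    (hJ1 : 1 ≤ J) (hK : 2 ≤ K)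
    (hK2 : 2 * var2 S p ≤ (K : ℝ) ^ 2 * var1 S p) (hn : J ≤ n)
    {f : ℤ × ℤ → ℝ} (hf : NHarm S p f) (hm : MonoQ f) {i j : ℤ} (hi : 1 ≤ i) (hin : i ≤ n)
    (hj1 : 1 ≤ j) (hj : j ≤ 3 * K * n) :
    n * f (i, j) ≤ 4 * (1 + J) * i * f (5 * K * n, 5 * K * n) := by
  have hKn : 2 * n ≤ K * n := by nlinarith
  have hnR : (1 : ℝ) ≤ n := by exact_mod_cast (by omega : (1 : ℤ) ≤ n)
  have hJR : (1 : ℝ) ≤ J := by exact_mod_cast hJ1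
  have hJn : (J : ℝ) ≤ n := by exact_mod_cast hn
  have hKR : (2 : ℝ) ≤ K := by exact_mod_cast hK
  have hiR : (1 : ℝ) ≤ i := by exact_mod_cast hi
  have hinR : (i : ℝ) ≤ n := by exact_mod_cast hin
  have hF : 0 ≤ f (5 * K * n, 5 * K * n) := hf.nonneg _
  have hFle : ∀ y : ℤ × ℤ, y.1 ≤ 5 * K * n → y.2 ≤ 5 * K * n →
      f y ≤ f (5 * K * n, 5 * K * n) := by
    intro y h1 h2
    by_cases hy : InQ y
    · exact hm.le hy h1 h2
    · rw [hf.zero y hy]; exact hF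
  rcases hin.lt_or_eq with hlt | rfl
  swap
  · have : f (i, j) ≤ f (5 * K * i, 5 * K * i) :=
      hFle _ (by show i ≤ _; nlinarith) (by show j ≤ _; nlinarith)
    calc (i : ℝ) * f (i, j) ≤ i * f (5 * K * i, 5 * K * i) := by gcongr
      _ = 1 * (i * f (5 * K * i, 5 * K * i)) := by ring
      _ ≤ (4 * (1 + J)) * (i * f (5 * K * i, 5 * K * i)) := by gcongr; linarith
      _ = _ := by ring
  set F := f (5 * K * n, 5 * K * n) with hFdef
  have key := max_principle hw (Finset.Ioo 0 n ×ˢ Finset.Ioo (2 * K * n) (4 * K * n))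
    (fun x => F *
      ((K : ℝ) ^ 2 * (4 * n * J - J ^ 2) + ((K : ℝ) ^ 2 * (4 * n - 2 * J)) * x.1 +
        (-(K : ℝ) ^ 2) * (x.1 : ℝ) ^ 2 +
        1 * ((x.2 : ℝ) - 3 * K * n) ^ 2) - ((n : ℝ) ^ 2 * K ^ 2) * f x) ?_ ?_ (i, 3 * K * n) ?_
  · have hle : f (i, j) ≤ f (i, 3 * K * n) := hm.le ⟨hi, hj1⟩ le_rfl hj
    simp only at key
    push_cast at key
    have e : F * ((K : ℝ) ^ 2 * (4 * n * J - J ^ 2) + ((K : ℝ) ^ 2 * (4 * n - 2 * J)) * i +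
        (-(K : ℝ) ^ 2) * (i : ℝ) ^ 2 + 1 * (3 * (K : ℝ) * n - 3 * K * n) ^ 2) =
        (K : ℝ) ^ 2 * (F * (4 * n * (i + J) - (i + J) ^ 2)) := by ring
    rw [e] at key
    have h3 : ((K : ℝ) ^ 2) * (n ^ 2 * f (i, 3 * K * n)) ≤
        (K : ℝ) ^ 2 * (F * (4 * n * (i + J) - (i + J) ^ 2)) := by linarith
    have h4 := le_of_mul_le_mul_left h3 (by positivity)
    have h5 : F * (4 * n * (i + J) - (i + J) ^ 2) ≤ F * (4 * n * (i * (1 + J))) := by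
      gcongr
      have : (i : ℝ) + J ≤ i * (1 + J) := by nlinarith
      have : 4 * (n : ℝ) * (i + J) ≤ 4 * n * (i * (1 + J)) := by gcongr
      nlinarith [sq_nonneg ((i : ℝ) + J)]
    have h6 : (n : ℝ) * (n * f (i, 3 * K * n)) ≤ n * (4 * (1 + J) * i * F) := by linarith
    have h7 := le_of_mul_le_mul_left h6 (by positivity)
    have : (n : ℝ) * f (i, j) ≤ n * f (i, 3 * K * n) := by gcongr
    linarith
  · intro x hx
    simp only [Finset.mem_product, Finset.mem_Ioo] at hx
    obtain ⟨⟨x1, x2⟩, x3, x4⟩ := hx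
    rw [avg_sub', avg_quad hw, hf.eq x ⟨by omega, by nlinarith⟩]
    have := var2_pos hw
    have : 0 ≤ F * ((K : ℝ) ^ 2 * var1 S p - var2 S p) := mul_nonneg hF (by linarith)
    nlinarith
  · intro x hx s hs hy
    simp only [Finset.mem_product, Finset.mem_Ioo] at hx
    obtain ⟨⟨x1, x2⟩, x3, x4⟩ := hx
    obtain ⟨s1, s2⟩ := hJ s hs
    rw [abs_le] at s1 s2
    have y1 : -J ≤ (x + s).1 := by simp only [Prod.fst_add]; omega
    have y2 : (x + s).1 ≤ n + J := by simp only [Prod.fst_add]; omega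
    have y3 : (x + s).2 ≤ 5 * K * n := by simp only [Prod.snd_add]; nlinarith
    generalize x + s = y at hy y1 y2 y3
    have y1R : -(J : ℝ) ≤ y.1 := by exact_mod_cast y1
    have y2R : (y.1 : ℝ) ≤ n + J := by exact_mod_cast y2
    have hfy := hFle y (by nlinarith) y3
    rw [sub_nonneg]
    have e : (K : ℝ) ^ 2 * (4 * n * J - J ^ 2) + ((K : ℝ) ^ 2 * (4 * n - 2 * J)) * y.1 +
        (-(K : ℝ) ^ 2) * (y.1 : ℝ) ^ 2 + 1 * ((y.2 : ℝ) - 3 * K * n) ^ 2 =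
        (K : ℝ) ^ 2 * ((y.1 + J) * (4 * n - (y.1 + J))) + ((y.2 : ℝ) - 3 * K * n) ^ 2 := by ring
    rw [e]
    have hw0 : 0 ≤ ((y.1 : ℝ) + J) * (4 * n - (y.1 + J)) :=
      mul_nonneg (by linarith) (by linarith)
    have hK0 : 0 ≤ (K : ℝ) ^ 2 * (((y.1 : ℝ) + J) * (4 * n - (y.1 + J))) := by positivity
    by_cases c2 : y.1 ≤ 0
    · rw [hf.zero y (fun h => by have := h.1; omega), mul_zero]
      positivity
    · push Not at c2
      have hv : (n : ℝ) ^ 2 * K ^ 2 ≤ (K : ℝ) ^ 2 * ((y.1 + J) * (4 * n - (y.1 + J))) +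
          ((y.2 : ℝ) - 3 * K * n) ^ 2 := by
        by_cases c1 : n ≤ y.1
        · have c1R : (n : ℝ) ≤ y.1 := by exact_mod_cast c1
          have h8 : (n : ℝ) ^ 2 ≤ (y.1 + J) * (4 * n - (y.1 + J)) := by
            nlinarith [mul_nonneg (by linarith : (0 : ℝ) ≤ y.1 + J - n)
              (by linarith : (0 : ℝ) ≤ 3 * n - (y.1 + J))]
          have h9 : (K : ℝ) ^ 2 * (n : ℝ) ^ 2 ≤
            (K : ℝ) ^ 2 * ((y.1 + J) * (4 * n - (y.1 + J))) := by gcongr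
          nlinarith [sq_nonneg ((y.2 : ℝ) - 3 * K * n)]
        · push Not at c1
          have c3 : y.2 ≤ 2 * K * n ∨ 4 * K * n ≤ y.2 := by
            by_contra hcon
            push Not at hcon
            exact hy (by simp only [Finset.mem_product, Finset.mem_Ioo]; exact ⟨⟨c2, c1⟩, hcon⟩)
          have hsq : ((K : ℝ) * n) ^ 2 ≤ ((y.2 : ℝ) - 3 * K * n) ^ 2 := by
            have hp : (0 : ℝ) ≤ K * n := by positivity
            rcases c3 with c3 | c3
            · have c3R : (y.2 : ℝ) ≤ 2 * K * n := by exact_mod_cast c3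
              nlinarith
            · have c3R : 4 * (K : ℝ) * n ≤ y.2 := by exact_mod_cast c3
              nlinarith
          nlinarith
      calc (n : ℝ) ^ 2 * K ^ 2 * f y ≤ (n : ℝ) ^ 2 * K ^ 2 * F := by gcongr
        _ = F * ((n : ℝ) ^ 2 * K ^ 2) := by ring
        _ ≤ _ := by gcongr
  · simp only [Finset.mem_product, Finset.mem_Ioo]
    refine ⟨⟨by omega, hlt⟩, by nlinarith, by nlinarith⟩

/-- ellipticity -/
theorem elliptic (hw : QWalk S p) : ∃ c : ℝ, 0 < c ∧ ∀ a b : ℝ,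
    a ^ 2 + b ^ 2 ≤ c * ∑ s ∈ S, p s * (s.1 * a + s.2 * b) ^ 2 := by
  have h : ∀ z : ℤ × ℤ, ∃ c : ℝ, 0 < c ∧ ∀ a b : ℝ,
      (z.1 * a + z.2 * b) ^ 2 ≤ c * ∑ s ∈ S, p s * (s.1 * a + s.2 * b) ^ 2 := by
    intro z
    have hz : z ∈ AddSubgroup.closure (S : Set (ℤ × ℤ)) := by rw [hw.gen]; trivial
    induction hz using AddSubgroup.closure_induction with
    | mem s hs =>
      have hp := hw.pos s hs
      refine ⟨(p s)⁻¹, inv_pos.2 hp, fun a b => ?_⟩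
      rw [inv_mul_eq_div, le_div_iff₀ hp, mul_comm]
      exact Finset.single_le_sum (f := fun s : ℤ × ℤ => p s * ((s.1 : ℝ) * a + s.2 * b) ^ 2)
        (fun i hi => mul_nonneg (hw.pos i hi).le (sq_nonneg _)) hs
    | zero =>
      refine ⟨1, one_pos, fun a b => ?_⟩
      have := Finset.sum_nonneg (s := S) (f := fun s : ℤ × ℤ => p s * ((s.1 : ℝ) * a + s.2 * b) ^ 2)
        (fun i hi => mul_nonneg (hw.pos i hi).le (sq_nonneg _))
      simpa using this
    | add x y _ _ hx hy =>
      obtain ⟨c, hc, H⟩ := hx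
      obtain ⟨d, hd, H'⟩ := hy
      refine ⟨2 * c + 2 * d, by positivity, fun a b => ?_⟩
      have h1 := H a b
      have h2 := H' a b
      push_cast [Prod.fst_add, Prod.snd_add]
      nlinarith [sq_nonneg ((x.1 : ℝ) * a + x.2 * b - (y.1 * a + y.2 * b))]
    | neg x _ hx =>
      obtain ⟨c, hc, H⟩ := hx
      refine ⟨c, hc, fun a b => ?_⟩
      have h1 := H a b
      push_cast [Prod.fst_neg, Prod.snd_neg]
      nlinarith
  obtain ⟨c, hc, H⟩ := h (1, 0)
  obtain ⟨d, hd, H'⟩ := h (0, 1)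
  refine ⟨c + d, by positivity, fun a b => ?_⟩
  have h1 := H a b
  have h2 := H' a b
  simp at h1 h2
  linarith

end Barrier
section Doubling

variable {S : Finset (ℤ × ℤ)} {p : ℤ × ℤ → ℝ}

theorem sq_le_sinh_sq (y : ℝ) : y ^ 2 ≤ Real.sinh y ^ 2 := by
  rcases le_total 0 y with h | h
  · have := Real.self_le_sinh_iff.2 h
    nlinarith
  · have := Real.self_le_sinh_iff.2 (neg_nonneg.2 h)
    rw [Real.sinh_neg] at this
    nlinarith

theorem cosh_lower (y : ℝ) : 1 + 2 * y ^ 2 ≤ Real.cosh (2 * y) := by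
  rw [Real.cosh_two_mul, Real.cosh_sq]
  have := sq_le_sinh_sq y
  linarith

/-- gaussian subsolution -/
theorem gauss_sub (hw : QWalk S p) {c β B : ℝ} (hβ : 0 < β)
    (hell : ∀ a b : ℝ, a ^ 2 + b ^ 2 ≤ c * ∑ s ∈ S, p s * (s.1 * a + s.2 * b) ^ 2)
    (hc : 0 < c)
    (hB : ∀ s ∈ S, ((s.1 : ℝ) ^ 2 + (s.2 : ℝ) ^ 2) ≤ B) (hβB : β * B ≤ 1 / 2)
    (z : ℝ) (x : ℤ × ℤ)
    (hfar : c * (var1 S p + var2 S p) ≤ β * (((x.1 : ℝ) - z) ^ 2 + ((x.2 : ℝ) - z) ^ 2)) :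
    Real.exp (-β * (((x.1 : ℝ) - z) ^ 2 + ((x.2 : ℝ) - z) ^ 2)) ≤
    avg S p (fun x => Real.exp (-β * (((x.1 : ℝ) - z) ^ 2 + ((x.2 : ℝ) - z) ^ 2))) x := by
  set a := (x.1 : ℝ) - z with ha
  set b := (x.2 : ℝ) - z with hb
  have h1 : avg S p (fun x => Real.exp (-β * (((x.1 : ℝ) - z) ^ 2 + ((x.2 : ℝ) - z) ^ 2))) x =
      ∑ s ∈ S, p s * (Real.exp (-β * (a ^ 2 + b ^ 2)) *
        (Real.exp (-β * ((s.1 : ℝ) ^ 2 + (s.2 : ℝ) ^ 2)) *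
          Real.exp (-(2 * (β * (s.1 * a + s.2 * b)))))) := by
    unfold avg
    refine Finset.sum_congr rfl fun s _ => ?_
    rw [← Real.exp_add, ← Real.exp_add]
    congr 2
    rw [ha, hb]
    push_cast [Prod.fst_add, Prod.snd_add]
    ring
  have h2 : avg S p (fun x => Real.exp (-β * (((x.1 : ℝ) - z) ^ 2 + ((x.2 : ℝ) - z) ^ 2))) x =
      ∑ s ∈ S, p s * (Real.exp (-β * (a ^ 2 + b ^ 2)) *
        (Real.exp (-β * ((s.1 : ℝ) ^ 2 + (s.2 : ℝ) ^ 2)) *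
          Real.exp ((2 * (β * (s.1 * a + s.2 * b)))))) := by
    rw [h1, ← sum_neg_eq hw]
    refine Finset.sum_congr rfl fun s _ => ?_
    rw [hw.symm]
    congr 3
    · push_cast [Prod.fst_neg, Prod.snd_neg]
      ring_nf
    · push_cast [Prod.fst_neg, Prod.snd_neg]
      ring_nf
  have h3 : avg S p (fun x => Real.exp (-β * (((x.1 : ℝ) - z) ^ 2 + ((x.2 : ℝ) - z) ^ 2))) x =
      Real.exp (-β * (a ^ 2 + b ^ 2)) * ∑ s ∈ S, p s *
        (Real.exp (-β * ((s.1 : ℝ) ^ 2 + (s.2 : ℝ) ^ 2)) *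
          Real.cosh ((2 * (β * (s.1 * a + s.2 * b))))) := by
    have : ∀ A B C : ℝ, A = B → A = C → A = (B + C) / 2 := by
      intro A B C h h'
      linarith
    rw [this _ _ _ h1 h2, ← Finset.sum_add_distrib, Finset.mul_sum, Finset.sum_div]
    refine Finset.sum_congr rfl fun s _ => ?_
    rw [Real.cosh_eq]
    ring
  rw [h3]
  have h4 : ∀ s ∈ S, p s - β * (p s * (s.1 : ℝ) ^ 2) - β * (p s * (s.2 : ℝ) ^ 2) +
      β ^ 2 * (p s * (s.1 * a + s.2 * b) ^ 2) ≤ p s *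
        (Real.exp (-β * ((s.1 : ℝ) ^ 2 + (s.2 : ℝ) ^ 2)) *
          Real.cosh ((2 * (β * (s.1 * a + s.2 * b))))) := by
    intro s hs
    have e1 := Real.add_one_le_exp (-β * ((s.1 : ℝ) ^ 2 + (s.2 : ℝ) ^ 2))
    have e2 := cosh_lower (β * (s.1 * a + s.2 * b))
    have e3 : β * ((s.1 : ℝ) ^ 2 + (s.2 : ℝ) ^ 2) ≤ 1 / 2 := by
      have : β * ((s.1 : ℝ) ^ 2 + (s.2 : ℝ) ^ 2) ≤ β * B := by gcongr; exact hB s hs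
      linarith
    have e4 : (1 - β * ((s.1 : ℝ) ^ 2 + (s.2 : ℝ) ^ 2)) * (1 + 2 * (β * (s.1 * a + s.2 * b)) ^ 2) ≤
        Real.exp (-β * ((s.1 : ℝ) ^ 2 + (s.2 : ℝ) ^ 2)) *
          Real.cosh ((2 * (β * (s.1 * a + s.2 * b)))) :=
      mul_le_mul (by linarith) e2 (by positivity) (Real.exp_pos _).le
    have e5 : 1 - β * ((s.1 : ℝ) ^ 2 + (s.2 : ℝ) ^ 2) + (β * (s.1 * a + s.2 * b)) ^ 2 ≤
        (1 - β * ((s.1 : ℝ) ^ 2 + (s.2 : ℝ) ^ 2)) * (1 + 2 * (β * (s.1 * a + s.2 * b)) ^ 2) := by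
      nlinarith [mul_nonneg (by linarith : 0 ≤ 1 / 2 - β * ((s.1 : ℝ) ^ 2 + (s.2 : ℝ) ^ 2))
        (sq_nonneg (β * (s.1 * a + s.2 * b)))]
    calc _ = p s * (1 - β * ((s.1 : ℝ) ^ 2 + (s.2 : ℝ) ^ 2) + (β * (s.1 * a + s.2 * b)) ^ 2) := by
          ring
      _ ≤ _ := mul_le_mul_of_nonneg_left (e5.trans e4) (hw.pos s hs).le
  have h5 := Finset.sum_le_sum h4
  simp only [Finset.sum_add_distrib, Finset.sum_sub_distrib] at h5
  rw [← Finset.mul_sum, ← Finset.mul_sum, ← Finset.mul_sum, hw.sum] at h5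
  have h6 := hell a b
  set E := ∑ s ∈ S, p s * (s.1 * a + s.2 * b) ^ 2 with hEdef
  have h7 : var1 S p + var2 S p ≤ β * E := by
    have : c * (var1 S p + var2 S p) ≤ c * (β * E) := by
      calc _ ≤ β * (a ^ 2 + b ^ 2) := hfar
        _ ≤ β * (c * E) := by gcongr
        _ = _ := by ring
    exact le_of_mul_le_mul_left this hc
  have h8 : β * (var1 S p + var2 S p) ≤ β * (β * E) := by gcongr
  unfold var1 var2 at h8
  refine le_mul_of_one_le_right (Real.exp_pos _).le ?_
  nlinarith

theorem doubling (hw : QWalk S p) {J : ℤ} (hJ : ∀ s ∈ S, |s.1| ≤ J ∧ |s.2| ≤ J) (hJ1 : 1 ≤ J) :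
    ∃ C : ℝ, 1 ≤ C ∧ ∃ N : ℤ, 1 ≤ N ∧ ∀ g, NHarm S p g → MonoQ g → ∀ n : ℤ, N ≤ n →
      g (2 * n, 2 * n) ≤ C * g (n, n) := by
  obtain ⟨c, hc, hell⟩ := elliptic hw
  have hv1 := var1_pos hw
  have hv2 := var2_pos hw
  set α := c * (var1 S p + var2 S p) with hα
  have hαpos : 0 < α := by positivity
  have hexp : Real.exp (-(9 * α)) < Real.exp (-(8 * α)) := Real.exp_lt_exp.2 (by linarith)
  have hd : 0 < Real.exp (-(8 * α)) - Real.exp (-(9 * α)) := by linarith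
  obtain ⟨N, hN⟩ := exists_nat_ge (α * (2 * (J : ℝ) ^ 2) * 2)
  refine ⟨max 1 (Real.exp (-(8 * α)) - Real.exp (-(9 * α)))⁻¹, le_max_left _ _,
    (N : ℤ) + 1, by omega, fun g hg hm n hn => ?_⟩
  have hn1 : 1 ≤ n := by omega
  have hnR : (1 : ℝ) ≤ n := by exact_mod_cast hn1
  have hNn : (N : ℝ) ≤ n := by exact_mod_cast (by omega : (N : ℤ) ≤ n)
  have hG : 0 ≤ g (2 * n, 2 * n) := hg.nonneg _
  set G := g (2 * n, 2 * n) with hGdef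
  set β := α / (n : ℝ) ^ 2 with hβ
  have hβpos : 0 < β := by positivity
  have hβn : β * (n : ℝ) ^ 2 = α := by rw [hβ]; field_simp
  have key := max_principle hw
    ((Finset.Ioo 0 (6 * n) ×ˢ Finset.Ioo 0 (6 * n)).filter (fun x : ℤ × ℤ =>
      (x.1 - 3 * n) ^ 2 + (x.2 - 3 * n) ^ 2 < 9 * n ^ 2 ∧ ¬ (2 * n ≤ x.1 ∧ 2 * n ≤ x.2)))
    (fun x => 1 * g x - G * (Real.exp (-β * (((x.1 : ℝ) - 3 * n) ^ 2 + ((x.2 : ℝ) - 3 * n) ^ 2)) -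
      Real.exp (-(9 * α)))) ?_ ?_ (n, n) ?_
  · simp only at key
    have e : -β * (((n : ℝ) - 3 * n) ^ 2 + ((n : ℝ) - 3 * n) ^ 2) = -(8 * α) := by
      rw [← hβn]; ring
    rw [e] at key
    have h1 : G * (Real.exp (-(8 * α)) - Real.exp (-(9 * α))) ≤ g (n, n) := by linarith
    have h2 : G ≤ (Real.exp (-(8 * α)) - Real.exp (-(9 * α)))⁻¹ * g (n, n) := by
      rw [inv_mul_eq_div, le_div_iff₀ hd]
      exact h1
    refine h2.trans ?_
    gcongr
    · exact hg.nonneg _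
    · exact le_max_right _ _
  · intro x hx
    simp only [Finset.mem_filter, Finset.mem_product, Finset.mem_Ioo] at hx
    obtain ⟨⟨⟨x1, x2⟩, x3, x4⟩, x5, x6⟩ := hx
    rw [avg_sub', hg.eq x ⟨by omega, by omega⟩]
    have hfar : (n : ℤ) ^ 2 ≤ (x.1 - 3 * n) ^ 2 + (x.2 - 3 * n) ^ 2 := by
      by_cases c1 : 2 * n ≤ x.1
      · have c2 : x.2 < 2 * n := by
          by_contra hcon
          exact x6 ⟨c1, by omega⟩
        nlinarith [sq_nonneg (x.1 - 3 * n)]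
      · push Not at c1
        nlinarith [sq_nonneg (x.2 - 3 * n)]
    have hfarR : (n : ℝ) ^ 2 ≤ ((x.1 : ℝ) - 3 * n) ^ 2 + ((x.2 : ℝ) - 3 * n) ^ 2 := by
      exact_mod_cast hfar
    have hsub := gauss_sub hw (B := 2 * (J : ℝ) ^ 2) hβpos hell hc ?_ ?_ (3 * (n : ℝ)) x ?_
    · have e : avg S p (fun x : ℤ × ℤ =>
          Real.exp (-β * (((x.1 : ℝ) - 3 * n) ^ 2 + ((x.2 : ℝ) - 3 * n) ^ 2)) -
          Real.exp (-(9 * α))) x = avg S p (fun x : ℤ × ℤ =>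
          Real.exp (-β * (((x.1 : ℝ) - 3 * n) ^ 2 + ((x.2 : ℝ) - 3 * n) ^ 2))) x -
          Real.exp (-(9 * α)) := by
        unfold avg
        simp only [mul_sub, Finset.sum_sub_distrib]
        rw [← Finset.sum_mul, hw.sum, one_mul]
      rw [e]
      have := mul_le_mul_of_nonneg_left hsub hG
      nlinarith
    · intro s hs
      obtain ⟨s1, s2⟩ := hJ s hs
      have t1 : s.1 ^ 2 ≤ J ^ 2 := sq_le_sq' (by linarith [(abs_le.1 s1).1]) (abs_le.1 s1).2
      have t2 : s.2 ^ 2 ≤ J ^ 2 := sq_le_sq' (by linarith [(abs_le.1 s2).1]) (abs_le.1 s2).2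
      have t1R : (s.1 : ℝ) ^ 2 ≤ (J : ℝ) ^ 2 := by exact_mod_cast t1
      have t2R : (s.2 : ℝ) ^ 2 ≤ (J : ℝ) ^ 2 := by exact_mod_cast t2
      linarith
    · rw [hβ, div_mul_eq_mul_div, div_le_iff₀ (by positivity)]
      nlinarith
    · rw [← hα]
      calc α = β * (n : ℝ) ^ 2 := hβn.symm
        _ ≤ _ := by gcongr
  · intro x hx s hs hy
    generalize x + s = y at hy
    have hgy := hg.nonneg y
    rw [sub_nonneg, one_mul]
    by_cases c1 : 2 * n ≤ y.1 ∧ 2 * n ≤ y.2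
    · have h1 : G ≤ g y :=
        hm.le ⟨by show 1 ≤ 2 * n; omega, by show 1 ≤ 2 * n; omega⟩ c1.1 c1.2
      have h2 : Real.exp (-β * (((y.1 : ℝ) - 3 * n) ^ 2 + ((y.2 : ℝ) - 3 * n) ^ 2)) ≤ 1 := by
        rw [Real.exp_le_one_iff]
        have : 0 ≤ β * (((y.1 : ℝ) - 3 * n) ^ 2 + ((y.2 : ℝ) - 3 * n) ^ 2) := by positivity
        linarith
      have h3 := (Real.exp_pos (-(9 * α)))
      calc _ ≤ G * 1 := mul_le_mul_of_nonneg_left (by linarith) hG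
        _ ≤ _ := by linarith
    · have h1 : 9 * n ^ 2 ≤ (y.1 - 3 * n) ^ 2 + (y.2 - 3 * n) ^ 2 := by
        by_contra hcon
        push Not at hcon
        refine hy ?_
        have b1 : |y.1 - 3 * n| < 3 * n :=
          abs_lt_of_sq_lt_sq (by nlinarith [sq_nonneg (y.2 - 3 * n)]) (by omega)
        have b2 : |y.2 - 3 * n| < 3 * n :=
          abs_lt_of_sq_lt_sq (by nlinarith [sq_nonneg (y.1 - 3 * n)]) (by omega)
        rw [abs_lt] at b1 b2
        simp only [Finset.mem_filter, Finset.mem_product, Finset.mem_Ioo]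
        exact ⟨⟨⟨by omega, by omega⟩, by omega, by omega⟩, hcon, c1⟩
      have h1R : 9 * (n : ℝ) ^ 2 ≤ ((y.1 : ℝ) - 3 * n) ^ 2 + ((y.2 : ℝ) - 3 * n) ^ 2 := by
        exact_mod_cast h1
      have h2 : Real.exp (-β * (((y.1 : ℝ) - 3 * n) ^ 2 + ((y.2 : ℝ) - 3 * n) ^ 2)) ≤
          Real.exp (-(9 * α)) := by
        rw [Real.exp_le_exp, ← hβn]
        have := mul_le_mul_of_nonneg_left h1R hβpos.le
        linarith
      calc _ ≤ 0 := mul_nonpos_of_nonneg_of_nonpos hG (by linarith)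
        _ ≤ _ := hgy
  · simp only [Finset.mem_filter, Finset.mem_product, Finset.mem_Ioo]
    refine ⟨⟨⟨by omega, by omega⟩, by omega, by omega⟩, by nlinarith, by omega⟩

theorem doubling_iter {C : ℝ} (hC : 1 ≤ C) {N : ℤ} (hN : 1 ≤ N) {g : ℤ × ℤ → ℝ}
    (H : ∀ n : ℤ, N ≤ n → g (2 * n, 2 * n) ≤ C * g (n, n)) (k : ℕ) {n : ℤ} (hn : N ≤ n) :
    g (2 ^ k * n, 2 ^ k * n) ≤ C ^ k * g (n, n) := by
  induction k with
  | zero => simp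
  | succ k ih =>
    have h1 : N ≤ 2 ^ k * n := by
      have : (1 : ℤ) ≤ 2 ^ k := one_le_pow₀ (by norm_num)
      nlinarith
    have h2 := H _ h1
    have e : (2 : ℤ) ^ (k + 1) * n = 2 * (2 ^ k * n) := by ring
    rw [e]
    calc _ ≤ C * g (2 ^ k * n, 2 ^ k * n) := h2
      _ ≤ C * (C ^ k * g (n, n)) := by gcongr
      _ = _ := by ring

/-- swapped weights -/
theorem QWalk.swap (hw : QWalk S p) :
    QWalk (S.map (Equiv.prodComm ℤ ℤ).toEmbedding) (fun x => p x.swap) := by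
  refine ⟨?_, ?_, ?_, ?_, ?_⟩
  · intro s hs
    rw [Finset.mem_map_equiv] at hs
    exact hw.pos _ hs
  · rw [Finset.sum_map]
    simpa using hw.sum
  · intro s hs
    rw [Finset.mem_map_equiv] at hs ⊢
    exact hw.neg_mem _ hs
  · intro s
    exact hw.symm s.swap
  · have h := AddMonoidHom.map_closure (AddEquiv.prodComm (M := ℤ) (N := ℤ)).toAddMonoidHom
      (S : Set (ℤ × ℤ))
    rw [hw.gen, AddSubgroup.map_top_of_surjective _ (AddEquiv.surjective _)] at h
    rw [Finset.coe_map]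
    exact h.symm

theorem NHarm.swap {f : ℤ × ℤ → ℝ} (hf : NHarm S p f) :
    NHarm (S.map (Equiv.prodComm ℤ ℤ).toEmbedding) (fun x => p x.swap) (fun x => f x.swap) := by
  refine ⟨?_, fun x => hf.nonneg _, fun x hx => hf.zero _ fun h => hx ⟨h.2, h.1⟩⟩
  intro x hx
  rw [← hf.eq x.swap ⟨hx.2, hx.1⟩]
  unfold avg
  rw [Finset.sum_map]
  simp

theorem MonoQ.swap {f : ℤ × ℤ → ℝ} (hf : MonoQ f) : MonoQ (fun x => f x.swap) := by
  intro x u hx u1 u2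
  exact hf x.swap u.swap ⟨hx.2, hx.1⟩ u2 u1

theorem var1_swap : var1 (S.map (Equiv.prodComm ℤ ℤ).toEmbedding) (fun x => p x.swap) =
    var2 S p := by
  unfold var1 var2
  rw [Finset.sum_map]
  simp

theorem var2_swap : var2 (S.map (Equiv.prodComm ℤ ℤ).toEmbedding) (fun x => p x.swap) =
    var1 S p := by
  unfold var1 var2
  rw [Finset.sum_map]
  simp

theorem exists_jump_bound (S : Finset (ℤ × ℤ)) :
    ∃ J : ℤ, 1 ≤ J ∧ ∀ s ∈ S, |s.1| ≤ J ∧ |s.2| ≤ J := by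
  refine ⟨1 + ∑ s ∈ S, (|s.1| + |s.2|), ?_, fun s hs => ?_⟩
  · have : 0 ≤ ∑ s ∈ S, (|s.1| + |s.2|) := Finset.sum_nonneg fun s _ => by positivity
    omega
  · have := Finset.single_le_sum (f := fun s : ℤ × ℤ => |s.1| + |s.2|)
      (fun i _ => by positivity) hs
    have h1 := abs_nonneg s.1
    have h2 := abs_nonneg s.2
    refine ⟨?_, ?_⟩ <;> linarith

theorem exists_scale {a b : ℝ} (ha : 0 < a) (hb : 0 < b) :
    ∃ k : ℕ, 1 ≤ k ∧ 2 * b ≤ (((2 : ℤ) ^ k : ℤ) : ℝ) ^ 2 * a ∧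
      2 * a ≤ (((2 : ℤ) ^ k : ℤ) : ℝ) ^ 2 * b := by
  obtain ⟨m, hm⟩ := exists_nat_ge (2 * b / a + 2 * a / b)
  have h0 : 0 < 2 * b / a := by positivity
  have h0' : 0 < 2 * a / b := by positivity
  have h1 : (m : ℝ) ≤ 2 ^ m := by exact_mod_cast (Nat.lt_two_pow_self).le
  have h2 : (2 : ℝ) ^ m ≤ (((2 : ℤ) ^ (m + 1) : ℤ) : ℝ) ^ 2 := by
    push_cast
    have : (1 : ℝ) ≤ 2 ^ m := one_le_pow₀ (by norm_num)
    rw [pow_succ (2 : ℝ) m]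
    nlinarith
  refine ⟨m + 1, by omega, ?_, ?_⟩
  · rw [← div_le_iff₀ ha]
    linarith
  · rw [← div_le_iff₀ hb]
    linarith

/-- boundary Harnack comparison -/
theorem boundary_harnack (hw : QWalk S p) :
    ∃ C : ℝ, 0 < C ∧ ∃ N : ℤ, 1 ≤ N ∧ ∀ f g, NHarm S p f → MonoQ f → NHarm S p g → MonoQ g →
      ∀ n : ℤ, N ≤ n → ∀ x : ℤ × ℤ, InQ x → x.1 ≤ n → x.2 ≤ n →
        g (n, n) * f x ≤ C * f (n, n) * g x := by
  obtain ⟨J, hJ1, hJ⟩ := exists_jump_bound S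
  obtain ⟨k, hk1, hk2, hk3⟩ := exists_scale (var1_pos hw) (var2_pos hw)
  obtain ⟨C, hC, N, hN, hdoub⟩ := doubling hw hJ hJ1
  set K : ℤ := 2 ^ k with hKdef
  have hK : 2 ≤ K := by
    calc (2 : ℤ) = 2 ^ 1 := by norm_num
      _ ≤ 2 ^ k := pow_le_pow_right₀ (by norm_num) hk1
  have hJR : (1 : ℝ) ≤ J := by exact_mod_cast hJ1
  set A : ℝ := C ^ (k + 3) with hA
  have hA1 : 1 ≤ A := one_le_pow₀ hC
  refine ⟨24 * (1 + J) * A, by positivity, N + J, by omega,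
    fun f g hf fm hg gm n hn x hx hx1 hx2 => ?_⟩
  have hnJ : J ≤ n := by omega
  have hnR : (1 : ℝ) ≤ n := by exact_mod_cast (by omega : (1 : ℤ) ≤ n)
  have hKn : 2 * n ≤ K * n := by nlinarith
  have hnQ : InQ (n, n) := ⟨by show 1 ≤ n; omega, by show 1 ≤ n; omega⟩
  have hF0 : 0 ≤ f (n, n) := hf.nonneg _
  have hG0 : 0 ≤ g (n, n) := hg.nonneg _
  have hF5 : f (5 * K * n, 5 * K * n) ≤ A * f (n, n) := by
    have h1 := doubling_iter hC hN (hdoub f hf fm) (k + 3) (by omega : N ≤ n)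
    have e : (2 : ℤ) ^ (k + 3) * n = 8 * K * n := by rw [hKdef]; ring
    rw [e] at h1
    refine le_trans (fm.le ⟨?_, ?_⟩ ?_ ?_) h1
    · show 1 ≤ 5 * K * n; nlinarith
    · show 1 ≤ 5 * K * n; nlinarith
    · show 5 * K * n ≤ 8 * K * n; nlinarith
    · show 5 * K * n ≤ 8 * K * n; nlinarith
  have arm : ∀ (fy gy y : ℝ), 0 ≤ fy → 0 ≤ gy → 1 ≤ y → y * g (n, n) ≤ 6 * n * gy →
      n * fy ≤ 4 * (1 + J) * y * f (5 * K * n, 5 * K * n) →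
      g (n, n) * fy ≤ 24 * (1 + J) * A * f (n, n) * gy := by
    intro fy gy y hfy hgy hy h1 h2
    have h3 : n * fy ≤ 4 * (1 + J) * y * (A * f (n, n)) := h2.trans (by gcongr)
    have h4 : n * (g (n, n) * fy) ≤ n * (24 * (1 + J) * A * f (n, n) * gy) := by
      calc n * (g (n, n) * fy) = g (n, n) * (n * fy) := by ring
        _ ≤ g (n, n) * (4 * (1 + J) * y * (A * f (n, n))) := by gcongr
        _ = (4 * (1 + J) * (A * f (n, n))) * (y * g (n, n)) := by ring
        _ ≤ (4 * (1 + J) * (A * f (n, n))) * (6 * n * gy) := by gcongr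
        _ = _ := by ring
    exact le_of_mul_le_mul_left h4 (by linarith)
  have key := max_principle hw (Finset.Ioo 0 (2 * K * n) ×ˢ Finset.Ioo 0 (2 * K * n))
    (fun x => (24 * (1 + J) * A * f (n, n)) * g x - g (n, n) * f x) ?_ ?_ x ?_
  · linarith
  · intro y hy
    simp only [Finset.mem_product, Finset.mem_Ioo] at hy
    obtain ⟨⟨y1, y2⟩, y3, y4⟩ := hy
    have hyQ : InQ y := ⟨by omega, by omega⟩
    rw [avg_sub', hf.eq y hyQ, hg.eq y hyQ]
  · intro z hz s hs hy
    simp only [Finset.mem_product, Finset.mem_Ioo] at hz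
    obtain ⟨⟨z1, z2⟩, z3, z4⟩ := hz
    obtain ⟨s1, s2⟩ := hJ s hs
    rw [abs_le] at s1 s2
    have y1 : (z + s).1 ≤ 3 * K * n := by simp only [Prod.fst_add]; nlinarith
    have y2 : (z + s).2 ≤ 3 * K * n := by simp only [Prod.snd_add]; nlinarith
    generalize z + s = y at hy y1 y2
    rw [sub_nonneg]
    by_cases hyQ : InQ y
    swap
    · rw [hf.zero y hyQ, hg.zero y hyQ]; simp
    have hQ1 := hyQ.1
    have hQ2 := hyQ.2
    have hor : 2 * K * n ≤ y.1 ∨ 2 * K * n ≤ y.2 := by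
      by_contra hcon
      push Not at hcon
      exact hy (by
        simp only [Finset.mem_product, Finset.mem_Ioo]
        exact ⟨⟨by omega, hcon.1⟩, by omega, hcon.2⟩)
    by_cases c1 : y.1 < n
    · have c2 : 2 * K * n ≤ y.2 := by
        rcases hor with h | h
        · nlinarith
        · exact h
      refine arm (f y) (g y) y.1 (hf.nonneg _) (hg.nonneg _) (by exact_mod_cast hQ1) ?_ ?_
      · exact barrier_lower hw hJ hJ1 hK hk2 hnJ hg gm hQ1 c1.le c2
      · exact barrier_upper hw hJ hJ1 hK hk2 hnJ hf fm hQ1 c1.le hQ2 y2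
    by_cases c2 : y.2 < n
    · have c3 : 2 * K * n ≤ y.1 := by
        rcases hor with h | h
        · exact h
        · nlinarith
      have hJ' : ∀ s ∈ S.map (Equiv.prodComm ℤ ℤ).toEmbedding, |s.1| ≤ J ∧ |s.2| ≤ J := by
        intro s hs
        rw [Finset.mem_map_equiv] at hs
        exact (hJ _ hs).symm
      have hk' : 2 * var2 (S.map (Equiv.prodComm ℤ ℤ).toEmbedding) (fun x => p x.swap) ≤
          (K : ℝ) ^ 2 * var1 (S.map (Equiv.prodComm ℤ ℤ).toEmbedding) (fun x => p x.swap) := by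
        rw [var1_swap, var2_swap]
        exact hk3
      refine arm (f y) (g y) y.2 (hf.nonneg _) (hg.nonneg _) (by exact_mod_cast hQ2) ?_ ?_
      · exact barrier_lower hw.swap hJ' hJ1 hK hk' hnJ hg.swap gm.swap hQ2 c2.le c3
      · exact barrier_upper hw.swap hJ' hJ1 hK hk' hnJ hf.swap fm.swap hQ2 c2.le hQ1 y1
    push Not at c1 c2
    have h1 : g (n, n) ≤ g y := gm.le hnQ c1 c2
    have h2 : f y ≤ A * f (n, n) := by
      refine le_trans (fm.le hyQ ?_ ?_) hF5
      · show y.1 ≤ 5 * K * n; nlinarith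
      · show y.2 ≤ 5 * K * n; nlinarith
    have h3 := hg.nonneg y
    calc g (n, n) * f y ≤ g y * (A * f (n, n)) := by
          gcongr
          exact hf.nonneg _
      _ = 1 * (A * f (n, n) * g y) := by ring
      _ ≤ (24 * (1 + J)) * (A * f (n, n) * g y) := by
          gcongr
          linarith
      _ = _ := by ring
  · simp only [Finset.mem_product, Finset.mem_Ioo]
    have h1 := hx.1
    have h2 := hx.2
    refine ⟨⟨by omega, by nlinarith⟩, by omega, by nlinarith⟩

theorem compare (hw : QWalk S p) {f g : ℤ × ℤ → ℝ} (hf : NHarm S p f) (hg : NHarm S p g)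
    (hfp : ∀ x, InQ x → 0 < f x) (hgp : ∀ x, InQ x → 0 < g x) :
    ∃ C : ℝ, 0 < C ∧ ∀ x, f x ≤ C * g x := by
  have hq : InQ (1, 1) := ⟨le_rfl, le_rfl⟩
  have fm := harm_mono hw hf (hfp _ hq)
  have gm := harm_mono hw hg (hgp _ hq)
  obtain ⟨C, hC, N, hN, H⟩ := boundary_harnack hw
  have hf1 := hfp _ hq
  have hg1 := hgp _ hq
  refine ⟨C ^ 2 * f (1, 1) / g (1, 1), by positivity, fun x => ?_⟩
  by_cases hx : InQ x
  swap
  · rw [hf.zero x hx, hg.zero x hx, mul_zero]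
  have hx1 := hx.1
  have hx2 := hx.2
  set n := N + x.1 + x.2 with hn
  have hnQ : InQ (n, n) := ⟨by show 1 ≤ n; omega, by show 1 ≤ n; omega⟩
  have h1 := H f g hf fm hg gm n (by omega) x hx (by omega) (by omega)
  have h2 := H g f hg gm hf fm n (by omega) (1, 1) hq (by show 1 ≤ n; omega) (by show 1 ≤ n; omega)
  have hF := hfp _ hnQ
  have hG := hgp _ hnQ
  have hgx := hgp x hx
  rw [div_mul_eq_mul_div, le_div_iff₀ hg1]
  have h3 : g (n, n) * (f x * g (1, 1)) ≤ g (n, n) * (C ^ 2 * f (1, 1) * g x) := by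
    calc g (n, n) * (f x * g (1, 1)) = (g (n, n) * f x) * g (1, 1) := by ring
      _ ≤ (C * f (n, n) * g x) * g (1, 1) := by gcongr
      _ = C * g x * (f (n, n) * g (1, 1)) := by ring
      _ ≤ C * g x * (C * g (n, n) * f (1, 1)) := by gcongr
      _ = _ := by ring
  exact le_of_mul_le_mul_left h3 hG

theorem harm_unique (hw : QWalk S p) {f g : ℤ × ℤ → ℝ} (hf : NHarm S p f) (hg : NHarm S p g)
    (hfp : ∀ x, InQ x → 0 < f x) (hgp : ∀ x, InQ x → 0 < g x) :
    ∃ c : ℝ, 0 < c ∧ ∀ x, g x = c * f x := by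
  have hq : InQ (1, 1) := ⟨le_rfl, le_rfl⟩
  set T : Set ℝ := {c | 0 ≤ c ∧ ∀ x, c * f x ≤ g x} with hT
  have hT0 : (0 : ℝ) ∈ T := ⟨le_rfl, fun x => by simpa using hg.nonneg x⟩
  have hTb : BddAbove T := by
    refine ⟨g (1, 1) / f (1, 1), fun c hc => ?_⟩
    rw [le_div_iff₀ (hfp _ hq)]
    exact hc.2 _
  set c := sSup T with hc
  have hcT : ∀ x, c * f x ≤ g x := by
    intro x
    by_cases hx : InQ x
    · rw [← le_div_iff₀ (hfp x hx)]
      refine csSup_le ⟨0, hT0⟩ fun d hd => ?_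
      rw [le_div_iff₀ (hfp x hx)]
      exact hd.2 x
    · rw [hf.zero x hx, hg.zero x hx, mul_zero]
  have hc0 : 0 ≤ c := le_csSup hTb hT0
  have hh : NHarm S p ((1 : ℝ) • g + (-c) • f) := hg.comb hf fun x => by linarith [hcT x]
  by_cases hz : ∃ y, InQ y ∧ ((1 : ℝ) • g + (-c) • f) y = 0
  · obtain ⟨y, hy, hy0⟩ := hz
    have h0 := hf.eq_zero_of hw (hfp _ hq) hh hy hy0
    have h1 : ∀ x, g x = c * f x := by
      intro x
      have := congrFun h0 x
      simp at this
      linarith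
    refine ⟨c, lt_of_le_of_ne hc0 fun h => ?_, h1⟩
    have := h1 (1, 1)
    rw [← h, zero_mul] at this
    exact (hgp _ hq).ne' this
  · push Not at hz
    obtain ⟨C, hC, H⟩ := compare hw hf hh hfp fun x hx =>
      lt_of_le_of_ne (hh.nonneg x) (hz x hx).symm
    have hmem : c + C⁻¹ ∈ T := by
      refine ⟨by positivity, fun x => ?_⟩
      have h1 := H x
      simp only [Pi.add_apply, Pi.smul_apply, smul_eq_mul, one_mul] at h1
      have h2 : C⁻¹ * f x ≤ g x + -c * f x := by
        rw [inv_mul_eq_div, div_le_iff₀ hC]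
        linarith
      linarith
    have := le_csSup hTb hmem
    have := inv_pos.2 hC
    linarith

end Doubling

theorem phiT_zero_le (p : ℤ × ℤ → ℝ) (hpos : ∀ kl : ℤ × ℤ, 0 ≤ p kl)
    (hfin : (Function.support p).Finite)
    (hsymm : ∀ kl : ℤ × ℤ, p kl = p (-kl)) (a : ℝ × ℝ) : ∑' kl, p kl ≤ phiT p a := by
  have hsupp : ∀ F : ℤ × ℤ → ℝ, Summable (fun s => p s * F s) := fun F =>
    summable_of_finite_support (hfin.subset fun s hs => by
      rw [Function.mem_support] at hs ⊢
      exact left_ne_zero_of_mul hs)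
  have h1 : phiT p a = ∑' kl : ℤ × ℤ, p kl * Real.exp (-(kl.1 * a.1 + kl.2 * a.2)) := by
    unfold phiT
    rw [← (Equiv.neg (ℤ × ℤ)).tsum_eq]
    refine tsum_congr fun s => ?_
    simp only [Equiv.neg_apply, ← hsymm]
    congr 2
    push_cast [Prod.fst_neg, Prod.snd_neg]
    ring
  have h2 : phiT p a + phiT p a = ∑' kl : ℤ × ℤ, p kl * (Real.exp (kl.1 * a.1 + kl.2 * a.2) +
      Real.exp (-(kl.1 * a.1 + kl.2 * a.2))) := by
    conv_lhs => rw [h1]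
    conv_lhs => enter [1]; rw [← h1]; unfold phiT
    rw [← (hsupp _).tsum_add (hsupp _)]
    exact tsum_congr fun s => by ring
  have h3 : ∑' kl, p kl * 2 ≤ ∑' kl : ℤ × ℤ, p kl * (Real.exp (kl.1 * a.1 + kl.2 * a.2) +
      Real.exp (-(kl.1 * a.1 + kl.2 * a.2))) := by
    refine Summable.tsum_le_tsum (fun s => mul_le_mul_of_nonneg_left ?_ (hpos s)) (hsupp _) (hsupp _)
    have := Real.one_le_cosh (s.1 * a.1 + s.2 * a.2)
    rw [Real.cosh_eq] at this
    linarith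
  rw [tsum_mul_right] at h3
  linarith

theorem harm_of_THarmonicF {p : ℤ × ℤ → ℝ} (hfin : (Function.support p).Finite)
    {f : ℤ → ℤ → ℝ} (hf : THarmonicF p 1 f) :
    NHarm hfin.toFinset p (fun x => f x.1 x.2) ∧ ∀ x : ℤ × ℤ, InQ x → 0 < f x.1 x.2 := by
  obtain ⟨h1, h2, h3⟩ := hf
  have hz : ∀ x : ℤ × ℤ, ¬ InQ x → f x.1 x.2 = 0 := by
    intro x hx
    apply h3
    by_contra hcon
    push Not at hcon
    exact hx ⟨by omega, by omega⟩
  refine ⟨⟨fun x hx => ?_, fun x => ?_, hz⟩, fun x hx => h2 _ _ hx.1 hx.2⟩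
  · have := h1 x.1 x.2 hx.1 hx.2
    rw [one_mul] at this
    rw [← this]
    unfold avg
    symm
    refine tsum_eq_sum fun s hs => ?_
    have : p s = 0 := by simpa using hs
    rw [this, zero_mul]
  · by_cases hx : InQ x
    · exact (h2 _ _ hx.1 hx.2).le
    · exact (hz x hx).ge

/-- for symmetric weights with bounded jumps whose support generates `ℤ²`, the
`t₀`-harmonic function is unique up to a positive multiplicative constant. -/
theorem symmetric_t0Harmonic_unique_up_to_constant
    (p : ℤ × ℤ → ℝ)
    (hpos : ∀ kl : ℤ × ℤ, 0 ≤ p kl)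
    (hfin : (Function.support p).Finite)
    (hsum : ∑' kl : ℤ × ℤ, p kl = 1)
    (hsymm : ∀ kl : ℤ × ℤ, p kl = p (-kl))
    (hgen : AddSubgroup.closure (Function.support p) = ⊤)
    (t0 : ℝ) (ht0 : IsLeast (Set.range (phiT p)) t0)
    (f g : ℤ → ℤ → ℝ) (hf : THarmonicF p t0 f) (hg : THarmonicF p t0 g) :
    ∃ c > 0, ∀ i j : ℤ, g i j = c * f i j := by
  have ht : t0 = 1 := by
    apply le_antisymm
    · refine ht0.2 ⟨0, ?_⟩
      unfold phiT
      simpa using hsum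
    · obtain ⟨a, ha⟩ := ht0.1
      rw [← ha, ← hsum]
      exact phiT_zero_le p hpos hfin hsymm a
  subst ht
  obtain ⟨f1, f2⟩ := harm_of_THarmonicF hfin hf
  obtain ⟨g1, g2⟩ := harm_of_THarmonicF hfin hg
  have hw : QWalk hfin.toFinset p := by
    refine ⟨fun s hs => ?_, ?_, fun s hs => ?_, fun s => (hsymm s).symm, ?_⟩
    · rw [Set.Finite.mem_toFinset, Function.mem_support] at hs
      exact lt_of_le_of_ne (hpos s) hs.symm
    · rw [← hsum]
      symm
      refine tsum_eq_sum fun s hs => ?_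
      simpa using hs
    · rw [Set.Finite.mem_toFinset, Function.mem_support] at hs ⊢
      rwa [← hsymm]
    · rw [Set.Finite.coe_toFinset]
      exact hgen
  obtain ⟨c, hc, H⟩ := harm_unique hw f1 g1 f2 g2
  exact ⟨c, hc, fun i j => H (i, j)⟩
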